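/- Let d, s ≥ 2 be integers with d + s > 5. Then the set Sep_{d,s} of separable quantum states in Her_d ⊗ Her_s (viewed as a subset of the real vector space Her_{ds} of Hermitian ds×ds complex matrices, via the Kronecker product) is not a spectrahedral shadow. -/

import Mathlib

open Matrix
open scoped Kronecker ComplexOrder

/-- A set `S` in a real vector space `V` is a spectrahedral shadow if it is the image,
under a linear map, of a spectrahedron `{x ∈ ℝⁿ | A₀ + x₁A₁ + ⋯ + xₙAₙ ⪰ 0}` described
by Hermitian matrices `A₀, A₁, …, Aₙ`. -/
def IsSpectrahedralShadow {V : Type*} [AddCommGroup V] [Module ℝ V] (S : Set V) : Prop :=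
  ∃ (n m : ℕ) (A₀ : Matrix (Fin m) (Fin m) ℂ) (A : Fin n → Matrix (Fin m) (Fin m) ℂ)
    (L : (Fin n → ℝ) →ₗ[ℝ] V),
    A₀.IsHermitian ∧ (∀ i, (A i).IsHermitian) ∧
      S = L '' {x : Fin n → ℝ | (A₀ + ∑ i, x i • A i).PosSemidef}

/-- `ρ ∈ Her_d ⊗ Her_s` is separable if it is a sum of Kronecker products of positive
semidefinite matrices. -/
def SeparableMat {d s : ℕ} (ρ : Matrix (Fin d × Fin s) (Fin d × Fin s) ℂ) : Prop :=
  ∃ (r : ℕ) (σ : Fin r → Matrix (Fin d) (Fin d) ℂ) (τ : Fin r → Matrix (Fin s) (Fin s) ℂ),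
    (∀ i, (σ i).PosSemidef) ∧ (∀ i, (τ i).PosSemidef) ∧ ρ = ∑ i, σ i ⊗ₖ τ i

def realify {m : ℕ} : Matrix (Fin m) (Fin m) ℂ →ₗ[ℝ] Matrix (Fin m ⊕ Fin m) (Fin m ⊕ Fin m) ℝ where
  toFun M := fromBlocks (M.map Complex.re) (-(M.map Complex.im)) (M.map Complex.im) (M.map Complex.re)
  map_add' M N := by ext (i | i) (j | j) <;> simp [add_comm]
  map_smul' c M := by ext (i | i) (j | j) <;> simp

theorem realify_isHermitian {m : ℕ} {M : Matrix (Fin m) (Fin m) ℂ} (h : M.IsHermitian) : (realify M).IsHermitian := by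
  ext (i | i) (j | j)
  all_goals
    have h1 := congrArg Complex.re (h.apply i j)
    have h2 := congrArg Complex.im (h.apply i j)
    simp at h1 h2
    simp [realify]
    linarith

theorem realify_quad {m : ℕ} (M : Matrix (Fin m) (Fin m) ℂ) (z : Fin m → ℂ) (w : Fin m ⊕ Fin m → ℝ) (hw : w = Sum.elim (fun i => (z i).re) (fun i => (z i).im)) :
    (star w ⬝ᵥ (realify M *ᵥ w)) = (star z ⬝ᵥ (M *ᵥ z)).re := by
  subst hw
  simp only [dotProduct, mulVec, Fintype.sum_sum_type, realify, Finset.mul_sum, Complex.re_sum, ← Finset.sum_add_distrib]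
  refine Finset.sum_congr rfl fun i _ => ?_
  refine Finset.sum_congr rfl fun j _ => ?_
  simp
  ring

theorem realify_posSemidef {m : ℕ} {M : Matrix (Fin m) (Fin m) ℂ} (h : M.IsHermitian) : (realify M).PosSemidef ↔ M.PosSemidef := by
  constructor
  · intro H
    refine .of_dotProduct_mulVec_nonneg h fun z => ?_
    rw [Complex.nonneg_iff]
    constructor
    · rw [← realify_quad M z _ rfl]
      exact H.dotProduct_mulVec_nonneg _
    · exact (h.im_star_dotProduct_mulVec_self z).symm
  · intro H
    refine .of_dotProduct_mulVec_nonneg (realify_isHermitian h) fun w => ?_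
    rw [realify_quad M (fun i => ⟨w (.inl i), w (.inr i)⟩) w (by ext (i|i) <;> rfl)]
    exact (Complex.nonneg_iff.1 (H.dotProduct_mulVec_nonneg _)).1

theorem factor_of_ker_le {J I I' : Type*} [Fintype J] [Fintype I] [Fintype I'] [DecidableEq J] [DecidableEq I] (B : Matrix I J ℝ) (C : Matrix I' J ℝ)
    (h : ∀ v, B *ᵥ v = 0 → C *ᵥ v = 0) : ∃ H : Matrix I' I ℝ, C = H * B := by
  have hk : LinearMap.ker B.mulVecLin ≤ LinearMap.ker C.mulVecLin := fun v hv => h v hv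
  let f := (LinearMap.ker B.mulVecLin).liftQ C.mulVecLin hk
  let e := B.mulVecLin.quotKerEquivRange
  obtain ⟨g, hg⟩ := LinearMap.exists_extend (f.comp e.symm.toLinearMap)
  refine ⟨LinearMap.toMatrix' g, ?_⟩
  apply Matrix.toLin'.injective
  rw [Matrix.toLin'_mul, Matrix.toLin'_toMatrix']
  refine LinearMap.ext fun v => ?_
  have := LinearMap.congr_fun hg ⟨B.mulVecLin v, v, rfl⟩
  have h2 : e.symm ⟨B.mulVecLin v, v, rfl⟩ = Submodule.Quotient.mk v := by
    rw [LinearEquiv.symm_apply_eq]; rfl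
  simp only [LinearMap.comp_apply, Submodule.subtype_apply, LinearEquiv.coe_coe, h2] at this
  simpa [f] using this.symm

open scoped MatrixOrder in
theorem exists_eq_transpose_mul_self {J : Type*} [Fintype J] [DecidableEq J] {A : Matrix J J ℝ} (h : A.PosSemidef) :
    ∃ B : Matrix J J ℝ, A = Bᵀ * B := by
  obtain ⟨B, hB⟩ := CStarAlgebra.nonneg_iff_eq_star_mul_self.mp h.nonneg
  exact ⟨B, by simpa [star_eq_conjTranspose] using hB⟩

theorem exists_minimal_face {n : ℕ} {J : Type*} [Fintype J] [DecidableEq J] (A₀ : Matrix J J ℝ) (A : Fin n → Matrix J J ℝ)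
    (hne : ∃ x : Fin n → ℝ, (A₀ + ∑ i, x i • A i).PosSemidef) :
    ∃ (u₀ : Fin n → ℝ) (B : Matrix J J ℝ), (A₀ + ∑ i, u₀ i • A i) = Bᵀ * B ∧ ∀ u : Fin n → ℝ, (A₀ + ∑ i, u i • A i).PosSemidef →
       ∃ H : Matrix J J ℝ, A₀ + ∑ i, u i • A i = Bᵀ * (Hᵀ * H) * B := by
  classical
  let M : (Fin n → ℝ) → Matrix J J ℝ := fun u => A₀ + ∑ i, u i • A i
  have hex : ∃ k, ∃ u : Fin n → ℝ, (M u).PosSemidef ∧ Module.finrank ℝ (LinearMap.ker (M u).mulVecLin) = k := by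
    obtain ⟨x, hx⟩ := hne
    exact ⟨_, x, hx, rfl⟩
  obtain ⟨u₀, hu₀, hk⟩ := Nat.find_spec hex
  have hmin : ∀ u, (M u).PosSemidef → ∀ v, M u₀ *ᵥ v = 0 → M u *ᵥ v = 0 := by
    intro u hu
    let w : Fin n → ℝ := fun i => (u₀ i + u i) / 2
    have hMw : M w = (1/2 : ℝ) • (M u₀ + M u) := by
      have : ∑ i, w i • A i = (1/2:ℝ) • (∑ i, u₀ i • A i + ∑ i, u i • A i) := by
        rw [← Finset.sum_add_distrib, Finset.smul_sum]
        refine Finset.sum_congr rfl fun i _ => ?_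
        rw [← add_smul, smul_smul]
        congr 1
        simp [w]; ring
      simp only [M, this]
      module
    have hw : (M w).PosSemidef := by
      rw [hMw]; exact (hu₀.add hu).smul (by norm_num)
    have hle : ∀ v, M w *ᵥ v = 0 → M u₀ *ᵥ v = 0 ∧ M u *ᵥ v = 0 := by
      intro v hv
      rw [hMw, smul_mulVec] at hv
      have hv' : (M u₀ + M u) *ᵥ v = 0 := by
        rcases smul_eq_zero.1 hv with h | h
        · norm_num at h
        · exact h
      have h1 := hu₀.dotProduct_mulVec_nonneg v
      have h2 := hu.dotProduct_mulVec_nonneg v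
      have h3 : star v ⬝ᵥ (M u₀ *ᵥ v) + star v ⬝ᵥ (M u *ᵥ v) = 0 := by
        rw [← dotProduct_add, ← add_mulVec, hv', dotProduct_zero]
      rw [← hu₀.dotProduct_mulVec_zero_iff, ← hu.dotProduct_mulVec_zero_iff]
      constructor <;> linarith
    have hsub : LinearMap.ker (M w).mulVecLin ≤ LinearMap.ker (M u₀).mulVecLin := fun v hv => (hle v hv).1
    have heq : LinearMap.ker (M w).mulVecLin = LinearMap.ker (M u₀).mulVecLin := by
      apply Submodule.eq_of_le_of_finrank_le hsub
      rw [hk]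
      exact Nat.find_min' hex ⟨w, hw, rfl⟩
    intro v hv
    have : v ∈ LinearMap.ker (M w).mulVecLin := by rw [heq]; exact hv
    exact (hle v this).2
  obtain ⟨B, hB⟩ := exists_eq_transpose_mul_self hu₀
  refine ⟨u₀, B, hB, fun u hu => ?_⟩
  obtain ⟨C, hC⟩ := exists_eq_transpose_mul_self hu
  change M u = _ at hC
  obtain ⟨H, hH⟩ := factor_of_ker_le B C (fun v hv => by
    have h1 : M u *ᵥ v = 0 := hmin u hu v (by rw [hB, ← mulVec_mulVec, hv, mulVec_zero])
    rw [hC] at h1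
    have := (conjTranspose_mul_self_mulVec_eq_zero C v).1 (by simpa using h1)
    exact this)
  refine ⟨H, ?_⟩
  change M u = _
  rw [hC, hH, transpose_mul]
  simp only [Matrix.mul_assoc]

open Cardinal in
theorem exists_infinite_basis (K : Subfield ℝ) [Countable K] : ∃ (ι : Type) (v : ι → ℝ), Infinite ι ∧ IsTranscendenceBasis K v := by
  obtain ⟨ι, v, hv⟩ := exists_isTranscendenceBasis' K ℝ
  refine ⟨ι, v, ?_, hv⟩
  by_contra h
  have : Finite ι := not_infinite_iff_finite.1 h
  have h1 : Countable ℝ := by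
    have h2 := hv.isAlgebraic
    have h3 := Algebra.IsAlgebraic.cardinalMk_le_max (Algebra.adjoin K (Set.range v)) ℝ
    have h4 : Cardinal.mk (Algebra.adjoin K (Set.range v)) ≤ ℵ₀ := by
      rw [← Cardinal.mk_congr hv.1.aevalEquiv.toEquiv]
      refine MvPolynomial.cardinalMk_le_max_lift.trans ?_
      simp
    rw [← Cardinal.mk_le_aleph0_iff]
    exact h3.trans (by simp [h4])
  exact Cardinal.not_countable_real (Set.countable_univ_iff.2 h1)

open MvPolynomial in
theorem exists_formal_taylor_of_isTranscendenceBasis (K : Subfield ℝ) (ι : Type) (v : ι → ℝ) (hv : IsTranscendenceBasis K v) (σ : Type) (N : ℕ) (e : σ ↪ ι) :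
   ∃ τ : ℝ →+* MvPolynomial σ ℝ ⧸ (idealOfVars σ ℝ ^ N),
     (∀ k : K, τ k = Ideal.Quotient.mk _ (C (k:ℝ))) ∧ (∀ i, τ (v (e i)) = Ideal.Quotient.mk _ (X i + C (v (e i)))) := by
  classical
  have hb : AlgebraicIndependent K v := hv.1
  set I := idealOfVars σ ℝ ^ N with hI
  let R := Algebra.adjoin K (Set.range v)
  have fs : Algebra.FormallySmooth R ℝ := by
    have := hv.isAlgebraic_field
    have : Algebra.FormallyEtale (IntermediateField.adjoin K (Set.range v)) ℝ :=
      Algebra.FormallyEtale.of_isSeparable _ ℝ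
    open scoped IntermediateField.algebraAdjoinAdjoin in
    have : Algebra.FormallySmooth (Algebra.adjoin K (Set.range v)) (IntermediateField.adjoin K (Set.range v)) :=
      .of_isLocalization (nonZeroDivisors _)
    exact .comp _ (IntermediateField.adjoin K (Set.range v)) _
  let y : ι → MvPolynomial σ ℝ := fun j => C (v j) + if h : ∃ i, e i = j then X h.choose else 0
  have hy : ∀ i, y (e i) = X i + C (v (e i)) := by
    intro i
    have h : ∃ i', e i' = e i := ⟨i, rfl⟩
    have h2 : h.choose = i := e.injective h.choose_spec
    simp only [y, dif_pos h, h2, add_comm]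
  let φ : R →+* MvPolynomial σ ℝ ⧸ I := (Ideal.Quotient.mk I).comp
    ((MvPolynomial.aeval (R := K) y : MvPolynomial ι K →ₐ[K] MvPolynomial σ ℝ).toRingHom.comp (hb.aevalEquiv.symm.toRingEquiv : R →+* MvPolynomial ι K))
  let _ : Algebra R (MvPolynomial σ ℝ ⧸ I) := φ.toAlgebra
  have hN : N = 0 ∨ I ≤ RingHom.ker (MvPolynomial.eval (0: σ → ℝ)) := by
    rcases N.eq_zero_or_pos with h | h
    · exact Or.inl h
    · right
      refine (Ideal.pow_le_self h.ne').trans ?_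
      rw [idealOfVars, Ideal.span_le]
      rintro _ ⟨i, rfl⟩
      simp
  rcases hN with rfl | hN
  · have : I = ⊤ := by simp [hI]
    have : Subsingleton (MvPolynomial σ ℝ ⧸ I) := Ideal.Quotient.subsingleton_iff.2 this
    exact ⟨{ toFun := fun _ => 0, map_one' := Subsingleton.elim _ _, map_mul' := fun _ _ => Subsingleton.elim _ _, map_zero' := rfl, map_add' := fun _ _ => Subsingleton.elim _ _}, fun _ => Subsingleton.elim _ _, fun _ => Subsingleton.elim _ _⟩
  let g0 : MvPolynomial σ ℝ ⧸ I →+* ℝ := Ideal.Quotient.lift I (MvPolynomial.eval (0: σ → ℝ)) hN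
  have g0mk : ∀ p, g0 (Ideal.Quotient.mk I p) = MvPolynomial.eval (0 : σ → ℝ) p := fun p => rfl
  have key : ∀ p : MvPolynomial ι K, φ (hb.aevalEquiv p) = Ideal.Quotient.mk I (MvPolynomial.aeval y p) := by
    intro p
    simp [φ]
  have key2 : ∀ r, g0 (φ r) = (r : ℝ) := by
    intro r
    obtain ⟨p, rfl⟩ := hb.aevalEquiv.surjective r
    rw [key]
    rw [g0mk, AlgebraicIndependent.aevalEquiv_apply_coe]
    have hy0 : ∀ j, MvPolynomial.eval (0 : σ → ℝ) (y j) = v j := by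
      intro j
      simp only [y]
      split_ifs <;> simp
    induction p using MvPolynomial.induction_on with
    | C a => simp
    | add p q hp hq => rw [map_add, map_add, map_add, hp, hq]
    | mul_X p i hp => rw [map_mul, map_mul, map_mul, hp, aeval_X, aeval_X, hy0]
  let g : MvPolynomial σ ℝ ⧸ I →ₐ[R] ℝ := { g0 with commutes' := key2 }
  have hg : Function.Surjective g := fun r => ⟨Ideal.Quotient.mk I (C r), by
    change g0 (Ideal.Quotient.mk I _) = _
    rw [g0mk]; simp⟩
  have hg' : IsNilpotent (RingHom.ker (g : MvPolynomial σ ℝ ⧸ I →+* ℝ)) := by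
    refine ⟨N, ?_⟩
    rw [Submodule.zero_eq_bot, ← le_bot_iff]
    have h1 : RingHom.ker (g : MvPolynomial σ ℝ ⧸ I →+* ℝ) ≤ (idealOfVars σ ℝ).map (Ideal.Quotient.mk I) := by
      intro q hq
      obtain ⟨p, rfl⟩ := Ideal.Quotient.mk_surjective q
      apply Ideal.mem_map_of_mem
      have hq' : g0 (Ideal.Quotient.mk I p) = 0 := hq
      rw [g0mk] at hq'
      rw [← pow_one (idealOfVars σ ℝ), mem_pow_idealOfVars_iff']
      intro m hm
      have : m = 0 := by
        rw [Nat.lt_one_iff] at hm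
        exact (Finsupp.degree_eq_zero_iff m).1 hm
      rw [this, ← hq']
      simp [← MvPolynomial.constantCoeff_eq]
    refine (Ideal.pow_right_mono h1 N).trans ?_
    rw [← Ideal.map_pow, Ideal.map_quotient_self]
  let τ := Algebra.FormallySmooth.liftOfSurjective (AlgHom.id R ℝ) g hg hg'
  have hτ : ∀ p, τ ((hb.aevalEquiv p : R) : ℝ) = Ideal.Quotient.mk I (MvPolynomial.aeval y p) := by
    intro p
    rw [← key]
    exact τ.commutes (hb.aevalEquiv p)
  refine ⟨(τ : ℝ →+* _), fun k => ?_, fun i => ?_⟩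
  · have h2 := hτ (C k)
    rw [AlgebraicIndependent.aevalEquiv_apply_coe, aeval_C, aeval_C] at h2
    exact h2
  · have h2 := hτ (X (e i))
    rw [AlgebraicIndependent.aevalEquiv_apply_coe, aeval_X, aeval_X, hy] at h2
    exact h2

open MvPolynomial in
theorem exists_formal_taylor (K : Subfield ℝ) [Countable K] (σ : Type) [Finite σ] (N : ℕ) :
    ∃ (x : σ → ℝ) (τ : ℝ →+ MvPolynomial σ ℝ),
      (∀ a b, τ (a * b) - τ a * τ b ∈ idealOfVars σ ℝ ^ N) ∧
      (∀ k ∈ K, ∀ a, τ (k * a) = C k * τ a) ∧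
      (∀ i, τ (x i) - (X i + C (x i)) ∈ idealOfVars σ ℝ ^ N) ∧
      τ 1 - 1 ∈ idealOfVars σ ℝ ^ N := by
  obtain ⟨ι, v, hι, hv⟩ := exists_infinite_basis K
  have := Fintype.ofFinite σ
  let e : σ ↪ ι := (Fintype.equivFin σ).toEmbedding.trans (Fin.valEmbedding.trans (Infinite.natEmbedding ι))
  set I := idealOfVars σ ℝ ^ N with hI
  obtain ⟨τ, h1, h2⟩ := exists_formal_taylor_of_isTranscendenceBasis K ι v hv σ N e
  obtain ⟨sec, hsec⟩ := LinearMap.exists_rightInverse_of_surjective (Ideal.Quotient.mkₐ ℝ I).toLinearMap (by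
    rw [LinearMap.range_eq_top]; exact Ideal.Quotient.mkₐ_surjective ℝ I)
  have hs : ∀ b, Ideal.Quotient.mk I (sec b) = b := fun b => LinearMap.congr_fun hsec b
  refine ⟨fun i => v (e i), sec.toAddMonoidHom.comp τ.toAddMonoidHom, fun a b => ?_, fun k hk a => ?_, fun i => ?_, ?_⟩
  · rw [← Ideal.Quotient.eq]
    simp [hs]
  · have : τ (k * a) = k • τ a := by
      rw [map_mul, h1 ⟨k, hk⟩]; exact (Algebra.smul_def (A := MvPolynomial σ ℝ ⧸ I) k (τ a)).symm
    simp [this, MvPolynomial.smul_eq_C_mul]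
  · rw [← Ideal.Quotient.eq, ← h2]
    simp [hs]
  · rw [← Ideal.Quotient.eq]
    simp [hs]

section Scaling
open MvPolynomial

/-- The dilation `X i ↦ δ X i` of the polynomial ring. -/
noncomputable def dilate {σ : Type} (δ : ℝ) : MvPolynomial σ ℝ →ₐ[ℝ] MvPolynomial σ ℝ :=
  MvPolynomial.aeval (fun i => C δ * X i)

theorem dilate_monomial {σ : Type} (δ : ℝ) (m : σ →₀ ℕ) (a : ℝ) :
    dilate δ (monomial m a) = δ ^ m.degree • monomial m a := by
  rw [dilate, aeval_monomial, monomial_eq, MvPolynomial.smul_eq_C_mul]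
  simp only [Finsupp.prod, mul_pow, Finset.prod_mul_distrib, MvPolynomial.algebraMap_eq, ← map_pow, ← map_prod,
    Finset.prod_pow_eq_pow_sum, Finsupp.degree_apply]
  ring

theorem dilate_eq_sum {σ : Type} (δ : ℝ) (p : MvPolynomial σ ℝ) :
    dilate δ p = ∑ m ∈ p.support, δ ^ m.degree • monomial m (p.coeff m) := by
  conv_lhs => rw [p.as_sum, map_sum]
  simp only [dilate_monomial]

theorem totalDegree_dilate_le {σ : Type} (δ : ℝ) (p : MvPolynomial σ ℝ) :
    (dilate δ p).totalDegree ≤ p.totalDegree := by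
  rw [dilate_eq_sum]
  refine totalDegree_finsetSum_le fun m hm => ?_
  refine (totalDegree_smul_le _ _).trans ?_
  refine (totalDegree_monomial_le _ _).trans ?_
  exact le_totalDegree hm

theorem dilate_bound {σ : Type} (N : ℕ) (ℓ : MvPolynomial σ ℝ →ₗ[ℝ] ℝ) (f : MvPolynomial σ ℝ)
    (hf : f ∈ idealOfVars σ ℝ ^ N) : ∃ c : ℝ, 0 ≤ c ∧ ∀ δ : ℝ, 0 < δ → δ ≤ 1 → |ℓ (dilate δ f)| ≤ c * δ ^ N := by
  refine ⟨∑ m ∈ f.support, |ℓ (monomial m (f.coeff m))|, Finset.sum_nonneg fun _ _ => abs_nonneg _, fun δ h0 h1 => ?_⟩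
  rw [dilate_eq_sum, map_sum, Finset.sum_mul]
  refine (Finset.abs_sum_le_sum_abs _ _).trans (Finset.sum_le_sum fun m hm => ?_)
  rw [map_smul, smul_eq_mul, abs_mul, mul_comm, abs_of_nonneg (pow_nonneg h0.le _)]
  refine mul_le_mul_of_nonneg_left ?_ (abs_nonneg _)
  exact pow_le_pow_of_le_one h0.le h1 ((mem_pow_idealOfVars_iff N f).1 hf m hm)

theorem uniform_bound {α : Type*} [Finite α] (g : α → ℝ → ℝ) (e : ℝ → ℝ) (he : ∀ δ, 0 < δ → δ ≤ 1 → 0 ≤ e δ)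
    (h : ∀ a, ∃ c : ℝ, 0 ≤ c ∧ ∀ δ : ℝ, 0 < δ → δ ≤ 1 → |g a δ| ≤ c * e δ) :
    ∃ c : ℝ, 0 ≤ c ∧ ∀ a, ∀ δ : ℝ, 0 < δ → δ ≤ 1 → |g a δ| ≤ c * e δ := by
  have := Fintype.ofFinite α
  choose c hc0 hc using h
  refine ⟨∑ a, c a, Finset.sum_nonneg fun a _ => hc0 a, fun a δ h0 h1 => (hc a δ h0 h1).trans ?_⟩
  exact mul_le_mul_of_nonneg_right (Finset.single_le_sum (f := c) (fun a _ => hc0 a) (Finset.mem_univ a)) (he δ h0 h1)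

theorem taylor_aeval {σ : Type} {N : ℕ} {x : σ → ℝ} {τ : ℝ →+ MvPolynomial σ ℝ}
    (h1 : ∀ a b, τ (a * b) - τ a * τ b ∈ idealOfVars σ ℝ ^ N)
    (h3 : ∀ i, τ (x i) - (X i + C (x i)) ∈ idealOfVars σ ℝ ^ N)
    (h4 : τ 1 - 1 ∈ idealOfVars σ ℝ ^ N) (p : MvPolynomial σ ℤ) :
    τ (aeval x p) - aeval (fun i => X i + C (x i)) p ∈ idealOfVars σ ℝ ^ N := by
  simp only [← Ideal.Quotient.eq] at *
  have h5 : ∀ n : ℤ, Ideal.Quotient.mk (idealOfVars σ ℝ ^ N) (τ n) = n := by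
    intro n
    have : τ (n : ℝ) = n • τ 1 := by rw [← map_zsmul]; simp
    rw [this, map_zsmul, h4]; simp
  induction p using MvPolynomial.induction_on with
  | C a => simp [h5]
  | add p q hp hq => simp only [map_add, hp, hq]
  | mul_X p i hp => simp only [map_mul, h1, aeval_X, hp, h3]
end Scaling

theorem posSemidef_of_small_entries {J : Type*} [Fintype J] [DecidableEq J] (E : Matrix J J ℝ) (ε c : ℝ) (hs : E.IsHermitian)
    (hE : ∀ i j, |E i j| ≤ ε) (hε : 0 ≤ ε) (hc : Fintype.card J * ε ≤ c) : (E + c • (1 : Matrix J J ℝ)).PosSemidef := by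
  refine .of_dotProduct_mulVec_nonneg (hs.add ?_) fun v => ?_
  · simp [Matrix.IsHermitian]
  · rw [add_mulVec, dotProduct_add, smul_mulVec, one_mulVec, dotProduct_smul]
    have h1 : |star v ⬝ᵥ (E *ᵥ v)| ≤ ε * (∑ i, |v i|) ^ 2 := by
      simp only [dotProduct, mulVec, Finset.mul_sum, sq, Finset.sum_mul]
      refine (Finset.abs_sum_le_sum_abs _ _).trans (Finset.sum_le_sum fun i _ => ?_)
      refine (Finset.abs_sum_le_sum_abs _ _).trans (Finset.sum_le_sum fun j _ => ?_)
      rw [abs_mul, abs_mul]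
      have := mul_le_mul_of_nonneg_right (hE i j) (mul_nonneg (abs_nonneg (v i)) (abs_nonneg (v j)))
      simp
      linarith
    have h2 : (∑ i, |v i|) ^ 2 ≤ Fintype.card J * ∑ i, |v i| ^ 2 := sq_sum_le_card_mul_sum_sq
    have h3 : star v ⬝ᵥ v = ∑ i, |v i| ^ 2 := by
      simp [dotProduct, sq]
    rw [h3, smul_eq_mul]
    have h4 : 0 ≤ ∑ i, |v i| ^ 2 := Finset.sum_nonneg fun _ _ => by positivity
    have h5 := mul_le_mul_of_nonneg_right hc h4
    have h6 := mul_le_mul_of_nonneg_left h2 hε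
    have := abs_le.1 h1
    nlinarith [this.1]

theorem feasible_perturbation {n : ℕ} {J : Type*} [Fintype J] [DecidableEq J] (A₀ : Matrix J J ℝ) (A : Fin n → Matrix J J ℝ)
    (B H : Matrix J J ℝ) (u₀ u : Fin n → ℝ) (hB : A₀ + ∑ i, u₀ i • A i = Bᵀ * B)
    (hH : A₀ + ∑ i, u i • A i = Bᵀ * (Hᵀ * H) * B) (K : Subfield ℝ) (hA₀K : ∀ a b, A₀ a b ∈ K) (hAK : ∀ i a b, A i a b ∈ K)
    (hBK : ∀ a b, B a b ∈ K) (θ : ℝ →+ ℝ) (hθ : ∀ k ∈ K, ∀ r, θ (k * r) = k * θ r) (t ε : ℝ) (ht : 0 ≤ t) (hε : 0 < ε)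
    (Z : Matrix J J ℝ) (hZ : Z.PosSemidef)
    (hZε : ∀ a b, |θ (∑ e, (√t * H e a) * (√t * H e b)) - Z a b| ≤ ε) (htε : - ε ≤ θ t) :
    ∃ (c : ℝ) (u' : Fin n → ℝ), 0 < c ∧ (A₀ + ∑ i, u' i • A i).PosSemidef ∧
      ∀ i, c * u' i = θ (t * u i) + (Fintype.card J + 2) * ε * u₀ i := by
  set κ : ℝ := Fintype.card J + 2 with hκ
  have hκ2 : 2 ≤ κ := by have : (0:ℝ) ≤ Fintype.card J := by positivity
                         linarith
  set c := θ t + κ * ε with hc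
  have hc0 : 0 < c := by nlinarith
  set Θ : Matrix J J ℝ := Matrix.of fun a b => θ (∑ e, (√t * H e a) * (√t * H e b)) with hΘ
  have hΘs : Θ.IsHermitian := by
    ext a b
    simp [hΘ, mul_comm]
  have hE := posSemidef_of_small_entries (Θ - Z) ε (κ * ε) (hΘs.sub hZ.isHermitian) (fun a b => hZε a b) hε.le (by nlinarith)
  have hS : (Θ + (κ * ε) • (1 : Matrix J J ℝ)).PosSemidef := by
    have := hZ.add hE
    convert this using 1
    abel
  have hθsum : θ t • A₀ + ∑ i, θ (t * u i) • A i = Bᵀ * Θ * B := by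
    ext a b
    have h1 : t * (A₀ a b) + ∑ i, (t * u i) * A i a b = ∑ d, ∑ c, (B c a * B d b) * (∑ e, (√t * H e c) * (√t * H e d)) := by
      have h2 : t * (A₀ a b) + ∑ i, (t * u i) * A i a b = t * (A₀ + ∑ i, u i • A i) a b := by
        simp [Matrix.add_apply, Matrix.sum_apply, mul_add, Finset.mul_sum, mul_assoc]
      rw [h2, hH]
      simp only [Matrix.mul_apply, Finset.mul_sum, Finset.sum_mul, transpose_apply]
      refine Finset.sum_congr rfl fun d _ => Finset.sum_congr rfl fun c _ => Finset.sum_congr rfl fun e _ => ?_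
      have := Real.mul_self_sqrt ht
      linear_combination (-(B c a * B d b * H e c * H e d)) * this
    have h3 := congrArg θ h1
    rw [map_add, map_sum, map_sum] at h3
    simp only [map_sum θ (fun c => _ * _) _] at h3
    simp only [mul_comm t (A₀ a b), mul_comm _ (A _ a b), hθ _ (hA₀K a b), hθ _ (hAK _ a b),
      hθ _ (K.mul_mem (hBK _ a) (hBK _ b))] at h3
    simp only [Matrix.add_apply, Matrix.sum_apply, Matrix.smul_apply, smul_eq_mul]
    simp only [mul_comm _ (A₀ a b), mul_comm _ (A _ a b)]
    rw [h3]
    simp only [Matrix.mul_apply, Finset.sum_mul, transpose_apply, hΘ, Matrix.of_apply]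
    refine Finset.sum_congr rfl fun d _ => Finset.sum_congr rfl fun c _ => ?_
    ring
  refine ⟨c, fun i => (θ (t * u i) + κ * ε * u₀ i) / c, hc0, ?_, fun i => by field_simp⟩
  have h5 : A₀ + ∑ i, ((θ (t * u i) + κ * ε * u₀ i) / c) • A i = c⁻¹ • (Bᴴ * (Θ + (κ * ε) • (1 : Matrix J J ℝ)) * B) := by
    have h6 : Bᴴ * (Θ + (κ * ε) • (1 : Matrix J J ℝ)) * B = c • A₀ + ∑ i, (θ (t * u i) + κ * ε * u₀ i) • A i := by
      rw [Matrix.mul_add, Matrix.add_mul, conjTranspose_eq_transpose_of_trivial, ← hθsum, Matrix.mul_smul, Matrix.mul_one, Matrix.smul_mul, ← hB, hc]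
      simp only [add_smul, Finset.sum_add_distrib, smul_add, Finset.smul_sum, smul_smul]
      abel
    rw [h6, smul_add, smul_smul, inv_mul_cancel₀ hc0.ne', one_smul, Finset.smul_sum]
    congr 1
    refine Finset.sum_congr rfl fun i _ => ?_
    rw [smul_smul]
    congr 1
    field_simp
  rw [h5]
  exact (hS.conjTranspose_mul_mul_same B).smul (inv_nonneg.2 hc0.le)

theorem exists_countable_subfield (T : Set ℝ) (hT : T.Countable) : ∃ K : Subfield ℝ, Countable K ∧ T ⊆ K := by
  refine ⟨Subfield.closure T, ?_, Subfield.subset_closure⟩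
  rw [← Cardinal.mk_le_aleph0_iff]
  refine (Subfield.cardinalMk_closure_le_max T).trans ?_
  simpa using hT.le_aleph0

theorem pi_basis_expand {V : Type*} [AddCommGroup V] [Module ℝ V] {n : ℕ} (L : (Fin n → ℝ) →ₗ[ℝ] V) (u : Fin n → ℝ) :
    L u = ∑ i, u i • L (Pi.single i 1) := by
  conv_lhs => rw [pi_eq_sum_univ' u, map_sum]
  simp

open MvPolynomial in
theorem eval_dilate_aeval {σ : Type} (δ : ℝ) (x z : σ → ℝ) (p : MvPolynomial σ ℤ) :
    eval z (dilate δ (aeval (fun i => X i + C (x i)) p)) = aeval (fun i => x i + δ * z i) p := by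
  induction p using MvPolynomial.induction_on with
  | C a => simp
  | add p q hp hq => simp only [map_add, hp, hq]
  | mul_X p i hp =>
    simp only [map_mul, hp, aeval_X]
    simp [dilate, add_comm]

open MvPolynomial in
theorem nonneg_of_isSpectrahedralShadow {V : Type*} [AddCommGroup V] [Module ℝ V] [Module.Finite ℝ V] {S : Set V}
    (hS : IsSpectrahedralShadow S) {σ κ : Type} [Finite σ] [Fintype κ] (e : κ → V) (N : κ → MvPolynomial σ ℤ)
    (t : MvPolynomial σ ℤ) (ht : ∀ x : σ → ℝ, 0 < aeval x t)
    (hN : ∀ x : σ → ℝ, (aeval x t)⁻¹ • ∑ k, aeval x (N k) • e k ∈ S) (Wp : MvPolynomial σ ℝ)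
    (W : (σ → ℝ) → ℝ → V →ₗ[ℝ] ℝ) (hWb : ∀ x v, ∃ c : ℝ, 0 ≤ c ∧ ∀ δ, 0 < δ → δ ≤ 1 → |W x δ v| ≤ c)
    (hWS : ∀ x δ, 0 < δ → δ ≤ 1 → ∀ s ∈ S, 0 ≤ W x δ s)
    (hWN : ∀ x δ, 0 < δ → δ ≤ 1 → ∀ z : σ → ℝ, W x δ (∑ k, aeval (fun i => x i + δ * z i) (N k) • e k) = δ ^ 4 * eval z Wp) :
    ∃ D : ℕ, ∀ ℓ : MvPolynomial σ ℝ →ₗ[ℝ] ℝ, (∀ q : MvPolynomial σ ℝ, q.totalDegree ≤ D → 0 ≤ ℓ (q * q)) → 0 ≤ ℓ Wp := by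
  obtain ⟨n, m, A₀', A', L, hA₀', hA', rfl⟩ := hS
  set A₀ := realify A₀' with hA₀
  set A := fun i => realify (A' i) with hA
  have hfeas : ∀ u : Fin n → ℝ, (A₀' + ∑ i, u i • A' i).PosSemidef ↔ (A₀ + ∑ i, u i • A i).PosSemidef := by
    intro u
    rw [← realify_posSemidef]
    · simp [hA₀, hA]
    · refine hA₀'.add ?_
      rw [Matrix.IsHermitian, conjTranspose_sum]
      exact Finset.sum_congr rfl fun i _ => by rw [conjTranspose_smul, (hA' i).eq]; simp
  simp only [hfeas] at hN hWS
  obtain ⟨u₀, B, hB, hface⟩ := exists_minimal_face A₀ A (by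
    obtain ⟨u, hu, -⟩ := hN 0
    exact ⟨u, hu⟩)
  let b := Module.finBasis ℝ V
  obtain ⟨K, hK, hTK⟩ := exists_countable_subfield
    ((Set.range fun p : (Fin m ⊕ Fin m) × (Fin m ⊕ Fin m) => A₀ p.1 p.2) ∪
     (Set.range fun p : Fin n × (Fin m ⊕ Fin m) × (Fin m ⊕ Fin m) => A p.1 p.2.1 p.2.2) ∪
     (Set.range fun p : (Fin m ⊕ Fin m) × (Fin m ⊕ Fin m) => B p.1 p.2) ∪
     (Set.range fun p : Fin n × Fin (Module.finrank ℝ V) => b.repr (L (Pi.single p.1 1)) p.2) ∪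
     (Set.range fun p : κ × Fin (Module.finrank ℝ V) => b.repr (e p.1) p.2)) (by
      repeat' apply Set.Countable.union
      all_goals exact Set.countable_range _)
  simp only [Set.union_subset_iff, Set.range_subset_iff, Prod.forall, SetLike.mem_coe] at hTK
  obtain ⟨⟨⟨⟨hA₀K, hAK⟩, hBK⟩, hLK⟩, heK⟩ := hTK
  obtain ⟨x, τ, h1, h2, h3, h4⟩ := exists_formal_taylor K σ 5
  obtain ⟨u, hu, hLu⟩ := hN x
  obtain ⟨H, hH⟩ := hface u hu
  set s := aeval x t with hs
  have hs0 : 0 < s := ht x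
  have hLu' : ∑ i, (s * u i) • L (Pi.single i 1) = ∑ k, aeval x (N k) • e k := by
    rw [pi_basis_expand L u] at hLu
    have h6 := congrArg (fun v => s • v) hLu
    simp only [smul_inv_smul₀ hs0.ne'] at h6
    simpa only [Finset.smul_sum, smul_smul] using h6
  have hθL : ∀ θ : ℝ →+ ℝ, (∀ k ∈ K, ∀ r, θ (k * r) = k * θ r) →
      ∑ i, θ (s * u i) • L (Pi.single i 1) = ∑ k, θ (aeval x (N k)) • e k := by
    intro θ hθ
    apply b.repr.injective
    ext j
    have h5 := congrArg (fun v => θ (b.repr v j)) hLu'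
    simpa [mul_comm _ (b.repr _ _), hθ _ (hLK _ _), hθ _ (heK _ _)] using h5
  obtain ⟨D, hD⟩ : ∃ D : ℕ, (∀ e a, (τ (√s * H e a)).totalDegree ≤ D) ∧ (τ √s).totalDegree ≤ D := by
    refine ⟨∑ e, ∑ a, (τ (√s * H e a)).totalDegree + (τ √s).totalDegree, fun e a => ?_, by omega⟩
    have h5 := Finset.single_le_sum (f := fun e => ∑ a, (τ (√s * H e a)).totalDegree) (fun _ _ => Nat.zero_le _) (Finset.mem_univ e)
    have h6 := Finset.single_le_sum (f := fun a => (τ (√s * H e a)).totalDegree) (fun _ _ => Nat.zero_le _) (Finset.mem_univ a)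
    have h7 := le_trans h6 h5
    exact h7.trans (Nat.le_add_right _ _)
  refine ⟨D, fun ℓ hℓ => ?_⟩
  let θ : ℝ → ℝ →+ ℝ := fun δ => (ℓ.toAddMonoidHom.comp (dilate δ).toLinearMap.toAddMonoidHom).comp τ
  have hθ : ∀ δ r, θ δ r = ℓ (dilate δ (τ r)) := fun _ _ => rfl
  have hθK : ∀ δ, ∀ k ∈ K, ∀ r, θ δ (k * r) = k * θ δ r := by
    intro δ k hk r
    rw [hθ, hθ, h2 k hk, ← MvPolynomial.smul_eq_C_mul, map_smul, map_smul, smul_eq_mul]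
  have hsq : ∀ δ, ∀ q : MvPolynomial σ ℝ, q.totalDegree ≤ D → 0 ≤ ℓ (dilate δ (q * q)) := by
    intro δ q hq
    rw [map_mul]
    exact hℓ _ ((totalDegree_dilate_le δ q).trans hq)
  let Z : ℝ → Matrix (Fin m ⊕ Fin m) (Fin m ⊕ Fin m) ℝ := fun δ => Matrix.of fun a b =>
    ℓ (dilate δ (∑ e, τ (√s * H e a) * τ (√s * H e b)))
  have hZ : ∀ δ, (Z δ).PosSemidef := by
    intro δ
    refine .of_dotProduct_mulVec_nonneg ?_ fun v => ?_
    · ext a b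
      simp [Z, mul_comm]
    · have h5 : star v ⬝ᵥ (Z δ *ᵥ v) = ∑ e, ℓ (dilate δ ((∑ a, v a • τ (√s * H e a)) * (∑ a, v a • τ (√s * H e a)))) := by
        simp only [dotProduct, mulVec, Z, Matrix.of_apply, Finset.mul_sum, Finset.sum_mul, map_sum]
        rw [Finset.sum_comm_cycle]
        refine Finset.sum_congr rfl fun e _ => ?_
        rw [Finset.sum_comm]
        refine Finset.sum_congr rfl fun a _ => Finset.sum_congr rfl fun b _ => ?_
        simp only [smul_mul_smul_comm, map_smul, smul_eq_mul, star_trivial]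
        ring_nf
      rw [h5]
      refine Finset.sum_nonneg fun e _ => hsq δ _ ?_
      exact totalDegree_finsetSum_le fun a _ => (totalDegree_smul_le _ _).trans (hD.1 e a)
  have hp5 : ∀ δ : ℝ, 0 < δ → δ ≤ 1 → 0 ≤ δ ^ 5 := fun δ h _ => by positivity
  obtain ⟨c1, hc10, hc1⟩ := uniform_bound (α := (Fin m ⊕ Fin m) × (Fin m ⊕ Fin m))
    (fun p δ => θ δ (∑ e, (√s * H e p.1) * (√s * H e p.2)) - Z δ p.1 p.2) (fun δ => δ ^ 5) hp5 (by
      rintro ⟨a, b⟩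
      obtain ⟨c, hc0, hc⟩ := dilate_bound 5 ℓ (τ (∑ e, (√s * H e a) * (√s * H e b)) - ∑ e, τ (√s * H e a) * τ (√s * H e b)) (by
        rw [map_sum, ← Finset.sum_sub_distrib]
        exact Ideal.sum_mem _ fun e _ => h1 _ _)
      refine ⟨c, hc0, fun δ hδ hδ' => ?_⟩
      have := hc δ hδ hδ'
      rwa [map_sub, map_sub] at this)
  obtain ⟨c2, hc20, hc2⟩ := dilate_bound 5 ℓ (τ (√s * √s) - τ √s * τ √s) (h1 _ _)
  obtain ⟨c3, hc30, hc3⟩ := uniform_bound (α := κ)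
    (fun k δ => θ δ (aeval x (N k)) - ℓ (dilate δ (aeval (fun i => X i + C (x i)) (N k)))) (fun δ => δ ^ 5) hp5 (by
      intro k
      obtain ⟨c, hc0, hc⟩ := dilate_bound 5 ℓ _ (taylor_aeval h1 h3 h4 (N k))
      refine ⟨c, hc0, fun δ hδ hδ' => ?_⟩
      have := hc δ hδ hδ'
      rwa [map_sub, map_sub] at this)
  choose we hwe0 hwe using fun k => hWb x (e k)
  obtain ⟨wu, hwu0, hwu⟩ := hWb x (L u₀)
  set c := c1 + c2 + 1 with hc
  set d : ℝ := Fintype.card (Fin m ⊕ Fin m) + 2 with hd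
  have hmain : ∀ δ : ℝ, 0 < δ → δ ≤ 1 → 0 ≤ ℓ Wp + δ * (∑ k, c3 * we k + d * c * wu) := by
    intro δ h0 h1'
    have hδ5 : 0 < δ ^ 5 := by positivity
    obtain ⟨y, u', hy0, hu', hyu⟩ := feasible_perturbation A₀ A B H u₀ u hB hH K hA₀K hAK hBK (θ δ) (hθK δ) s (c * δ ^ 5) hs0.le
      (by positivity) (Z δ) (hZ δ) (fun a b => (hc1 (a, b) δ h0 h1').trans (by nlinarith)) (by
        have h5 := hc2 δ h0 h1'
        rw [map_sub, map_sub, Real.mul_self_sqrt hs0.le] at h5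
        have h6 := hsq δ _ hD.2
        have h7 := (abs_le.1 h5).1
        rw [hθ]
        nlinarith)
    have h5 := hWS x δ h0 h1' (L u') ⟨u', hu', rfl⟩
    have h6 : y • L u' = ∑ k, θ δ (aeval x (N k)) • e k + (d * (c * δ ^ 5)) • L u₀ := by
      rw [← hθL (θ δ) (hθK δ), pi_basis_expand L u', pi_basis_expand L u₀, Finset.smul_sum, Finset.smul_sum,
        ← Finset.sum_add_distrib]
      refine Finset.sum_congr rfl fun i _ => ?_
      rw [smul_smul, smul_smul, ← add_smul, hyu]
    have h7 : 0 ≤ W x δ (y • L u') := by rw [map_smul, smul_eq_mul]; positivity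
    have h8 : ∑ k, ℓ (dilate δ (aeval (fun i => X i + C (x i)) (N k))) * W x δ (e k) = δ ^ 4 * ℓ Wp := by
      have h9 : ∑ k, W x δ (e k) • dilate δ (aeval (fun i => X i + C (x i)) (N k)) = δ ^ 4 • Wp := by
        apply MvPolynomial.funext
        intro z
        rw [MvPolynomial.smul_eval, ← hWN x δ h0 h1' z, map_sum, map_sum]
        refine Finset.sum_congr rfl fun k _ => ?_
        rw [MvPolynomial.smul_eval, map_smul, smul_eq_mul, mul_comm]
        congr 1
        rw [← eval_dilate_aeval]
      have h10 := congrArg ℓ h9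
      rw [map_sum, map_smul, smul_eq_mul] at h10
      rw [← h10]
      exact Finset.sum_congr rfl fun k _ => by rw [map_smul, smul_eq_mul, mul_comm]
    rw [h6, map_add, map_sum, map_smul, smul_eq_mul] at h7
    have h9 : ∑ k, W x δ (θ δ (aeval x (N k)) • e k) ≤ δ ^ 4 * ℓ Wp + ∑ k, c3 * we k * δ ^ 5 := by
      rw [← h8, ← Finset.sum_add_distrib]
      refine Finset.sum_le_sum fun k _ => ?_
      rw [map_smul, smul_eq_mul]
      have h10 := hc3 k δ h0 h1'
      have h11 := hwe k δ h0 h1'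
      have h12 := mul_le_mul h10 h11 (abs_nonneg _) (by positivity)
      rw [← abs_mul] at h12
      have := (abs_le.1 h12).2
      nlinarith
    have h10 : (d * (c * δ ^ 5)) * W x δ (L u₀) ≤ (d * (c * δ ^ 5)) * wu :=
      mul_le_mul_of_nonneg_left ((le_abs_self _).trans (hwu δ h0 h1')) (by positivity)
    rw [← Finset.sum_mul] at h9
    have h11 : 0 ≤ δ ^ 4 * (ℓ Wp + δ * (∑ k, c3 * we k + d * c * wu)) := by nlinarith
    exact nonneg_of_mul_nonneg_right h11 (by positivity)
  by_contra hneg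
  push Not at hneg
  set M := ∑ k, c3 * we k + d * c * wu with hM
  have hM0 : 0 ≤ M := by
    have : 0 ≤ ∑ k, c3 * we k := Finset.sum_nonneg fun k _ => mul_nonneg hc30 (hwe0 k)
    positivity
  have h5 := hmain (min 1 (-ℓ Wp / (2 * (M + 1)))) (lt_min one_pos (div_pos (by linarith) (by linarith))) (min_le_left _ _)
  have h6 : min 1 (-ℓ Wp / (2 * (M + 1))) * M ≤ -ℓ Wp / (2 * (M + 1)) * M :=
    mul_le_mul_of_nonneg_right (min_le_right _ _) hM0
  have h7 : -ℓ Wp / (2 * (M + 1)) * M < - ℓ Wp := by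
    rw [div_mul_eq_mul_div, div_lt_iff₀ (by linarith)]
    nlinarith
  linarith

open ComplexConjugate in
theorem graded_gram_nonneg {G : Type*} (F : Finset G) (gr : G → ℤ) (x : G → ℂ) :
    0 ≤ (∑ u ∈ F, ∑ v ∈ F, x u * conj (x v) * if gr u = gr v then (1 : ℂ) else 0).re := by
  classical
  have h : ∑ u ∈ F, ∑ v ∈ F, (x u * conj (x v) * if gr u = gr v then (1 : ℂ) else 0)
      = ∑ t ∈ F.image gr, (∑ u ∈ F with gr u = t, x u) * conj (∑ u ∈ F with gr u = t, x u) := by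
    simp only [map_sum, Finset.sum_mul_sum, Finset.sum_filter]
    rw [Finset.sum_comm' (s := F.image gr) (t := fun _ => F) (t' := F) (s' := fun _ => F.image gr) (by tauto)]
    refine Finset.sum_congr rfl fun u hu => ?_
    rw [Finset.sum_eq_single (gr u)]
    · rw [if_pos rfl]
      refine Finset.sum_congr rfl fun v _ => ?_
      by_cases h : gr u = gr v
      · simp [h]
      · simp [h, Ne.symm h]
    · intro t _ ht
      rw [if_neg (Ne.symm ht)]
      simp
    · intro h
      exact absurd (Finset.mem_image_of_mem gr hu) h
  rw [h, Complex.re_sum]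
  refine Finset.sum_nonneg fun t _ => ?_
  rw [Complex.mul_conj]
  exact_mod_cast Complex.normSq_nonneg _

open ComplexConjugate in
theorem kernel_nonneg {G : Type*} [DecidableEq G] (F : Finset G) (K : G → G → ℝ) (gr : G → ℤ) (n n' : G → ℝ) (c κ ε : ℝ)
    (hc : 0 ≤ c) (hε : 0 ≤ ε) (hκ : ε * (F.card) ≤ κ)
    (hdiag : ∀ u, κ * n u ^ 2 + c * n' u ^ 2 ≤ K u u)
    (hoff : ∀ u v, u ≠ v → |K u v - if gr u = gr v then c * (n' u * n' v) else 0| ≤ ε * (n u * n v)) (x : G → ℂ) :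
    0 ≤ (∑ u ∈ F, ∑ v ∈ F, x u * conj (x v) * (K u v : ℂ)).re := by
  have h1 := graded_gram_nonneg F gr (fun u => n' u * x u)
  set E : G → G → ℝ := fun u v => K u v - if gr u = gr v then c * (n' u * n' v) else 0 with hE
  have h2 : ∑ u ∈ F, ∑ v ∈ F, x u * conj (x v) * (K u v : ℂ)
      = (c : ℂ) * (∑ u ∈ F, ∑ v ∈ F, (n' u * x u) * conj (n' v * x v) * if gr u = gr v then (1 : ℂ) else 0)
        + ∑ u ∈ F, ∑ v ∈ F, x u * conj (x v) * (E u v : ℂ) := by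
    simp only [Finset.mul_sum, ← Finset.sum_add_distrib]
    refine Finset.sum_congr rfl fun u _ => Finset.sum_congr rfl fun v _ => ?_
    simp only [hE, map_mul, Complex.conj_ofReal]
    split_ifs
    · push_cast; ring
    · push_cast; ring
  rw [h2, Complex.add_re, Complex.re_ofReal_mul]
  have h3 : (∑ u ∈ F, κ * (n u * ‖x u‖) ^ 2) - ∑ u ∈ F, ∑ v ∈ F, ε * ((n u * ‖x u‖) * (n v * ‖x v‖))
      ≤ (∑ u ∈ F, ∑ v ∈ F, x u * conj (x v) * (E u v : ℂ)).re := by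
    rw [Complex.re_sum, ← Finset.sum_sub_distrib]
    refine Finset.sum_le_sum fun u hu => ?_
    rw [Complex.re_sum, sub_le_iff_le_add, ← Finset.sum_add_distrib]
    rw [← Finset.add_sum_erase _ _ hu]
    have h4 : 0 ≤ ∑ v ∈ F.erase u, ((x u * conj (x v) * (E u v : ℂ)).re + ε * ((n u * ‖x u‖) * (n v * ‖x v‖))) := by
      refine Finset.sum_nonneg fun v hv => ?_
      have h5 := hoff u v (Finset.ne_of_mem_erase hv).symm
      have h6 : |(x u * conj (x v) * (E u v : ℂ)).re| ≤ ‖x u‖ * ‖x v‖ * |E u v| := by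
        refine (Complex.abs_re_le_norm _).trans ?_
        rw [norm_mul, norm_mul, RCLike.norm_conj, Complex.norm_real, Real.norm_eq_abs]
      have h7 := mul_le_mul_of_nonneg_left h5 (mul_nonneg (norm_nonneg (x u)) (norm_nonneg (x v)))
      have := (abs_le.1 h6).1
      nlinarith
    have h5 : κ * (n u * ‖x u‖) ^ 2 ≤ (x u * conj (x u) * (E u u : ℂ)).re := by
      rw [Complex.mul_conj, ← Complex.ofReal_mul, Complex.ofReal_re, Complex.normSq_eq_norm_sq]
      have h6 : κ * n u ^ 2 ≤ E u u := by
        have := hdiag u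
        simp only [hE, if_true]
        nlinarith
      have := mul_le_mul_of_nonneg_left h6 (sq_nonneg ‖x u‖)
      nlinarith
    have h6 : 0 ≤ ε * ((n u * ‖x u‖) * (n u * ‖x u‖)) := mul_nonneg hε (mul_self_nonneg _)
    linarith
  have h4 : ∑ u ∈ F, ∑ v ∈ F, ε * ((n u * ‖x u‖) * (n v * ‖x v‖)) = ε * (∑ u ∈ F, n u * ‖x u‖) ^ 2 := by
    rw [sq, Finset.sum_mul_sum]
    simp only [Finset.mul_sum]
  have h5 : (∑ u ∈ F, n u * ‖x u‖) ^ 2 ≤ F.card * ∑ u ∈ F, (n u * ‖x u‖) ^ 2 := sq_sum_le_card_mul_sum_sq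
  rw [h4, ← Finset.mul_sum] at h3
  have h6 : 0 ≤ ∑ u ∈ F, (n u * ‖x u‖) ^ 2 := Finset.sum_nonneg fun _ _ => sq_nonneg _
  have h7 := mul_le_mul_of_nonneg_right hκ h6
  have h8 := mul_le_mul_of_nonneg_left h5 hε
  have h9 := mul_nonneg hc h1
  nlinarith

/-- Interchanges the two variables attached to every index. -/
def conjVar (ι : Type*) : ι × Bool ≃ ι × Bool := (Equiv.refl ι).prodCongr Equiv.boolNot

/-- Exponents of the conjugate of a monomial. -/
noncomputable def starExp {ι : Type*} (u : ι × Bool →₀ ℕ) : ι × Bool →₀ ℕ := u.mapDomain (conjVar ι)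

theorem starExp_apply {ι : Type*} (u : ι × Bool →₀ ℕ) (i : ι) (b : Bool) : starExp u (i, b) = u (i, !b) := by
  have := Finsupp.mapDomain_apply (conjVar ι).injective u (i, !b)
  simpa [conjVar, starExp] using this

/-- Rewrites a polynomial in real and imaginary parts as a polynomial in `z` and its conjugate. -/
noncomputable def toHol (ι : Type*) : MvPolynomial (ι × Bool) ℝ →ₐ[ℝ] MvPolynomial (ι × Bool) ℂ :=
  MvPolynomial.aeval fun i =>
    if i.2 then MvPolynomial.C (-Complex.I / 2) * (MvPolynomial.X (i.1, false) - MvPolynomial.X (i.1, true))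
    else MvPolynomial.C (1 / 2) * (MvPolynomial.X (i.1, false) + MvPolynomial.X (i.1, true))

/-- Complex conjugation of polynomials in `z` and its conjugate. -/
noncomputable def conjHol (ι : Type*) : MvPolynomial (ι × Bool) ℂ →+* MvPolynomial (ι × Bool) ℂ :=
  (MvPolynomial.rename (conjVar ι)).toRingHom.comp (MvPolynomial.map (starRingEnd ℂ))

theorem conjHol_monomial {ι : Type*} (u : ι × Bool →₀ ℕ) (c : ℂ) :
    conjHol ι (MvPolynomial.monomial u c) = MvPolynomial.monomial (starExp u) (starRingEnd ℂ c) := by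
  simp [conjHol, starExp, MvPolynomial.map_monomial, MvPolynomial.rename_monomial]

theorem conjHol_toHol {ι : Type*} (q : MvPolynomial (ι × Bool) ℝ) : conjHol ι (toHol ι q) = toHol ι q := by
  have : (conjHol ι).comp (toHol ι).toRingHom = (toHol ι).toRingHom := by
    refine MvPolynomial.ringHom_ext (fun r => ?_) (fun i => ?_)
    · simp [conjHol, toHol, MvPolynomial.algebraMap_eq, IsScalarTower.algebraMap_apply ℝ ℂ (MvPolynomial (ι × Bool) ℂ)]
    · rcases i with ⟨i, b⟩
      cases b
      · simp [conjHol, toHol, conjVar, add_comm, Complex.conj_ofNat]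
      · simp [conjHol, toHol, conjVar, Complex.conj_ofNat, neg_div]
        ring
  exact congrArg (fun f => f q) this

/-- The real functional with prescribed moments in `z` and its conjugate. -/
noncomputable def momentFunctional {ι : Type*} (M : (ι × Bool →₀ ℕ) → ℝ) : MvPolynomial (ι × Bool) ℝ →ₗ[ℝ] ℝ :=
  Complex.reLm ∘ₗ (((MvPolynomial.basisMonomials (ι × Bool) ℂ).constr ℂ fun g => (M g : ℂ)).restrictScalars ℝ) ∘ₗ
    (toHol ι).toLinearMap

theorem momentFunctional_apply {ι : Type*} (M : (ι × Bool →₀ ℕ) → ℝ) (q : MvPolynomial (ι × Bool) ℝ) :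
    momentFunctional M q
      = ((MvPolynomial.basisMonomials (ι × Bool) ℂ).constr ℂ (fun g => (M g : ℂ)) (toHol ι q)).re := rfl

theorem moments_monomial {ι : Type*} (M : (ι × Bool →₀ ℕ) → ℝ) (g : ι × Bool →₀ ℕ) (c : ℂ) :
    (MvPolynomial.basisMonomials (ι × Bool) ℂ).constr ℂ (fun g => (M g : ℂ)) (MvPolynomial.monomial g c)
      = c * M g := by
  have := (MvPolynomial.basisMonomials (ι × Bool) ℂ).constr_basis ℂ (fun g => (M g : ℂ)) g
  rw [MvPolynomial.coe_basisMonomials] at this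
  have h : MvPolynomial.monomial g c = c • MvPolynomial.monomial g (1 : ℂ) := by
    rw [MvPolynomial.smul_monomial, smul_eq_mul, mul_one]
  rw [h, map_smul, this, smul_eq_mul]

open ComplexConjugate in
theorem momentFunctional_sq_nonneg {ι : Type*} [Finite ι] (D : ℕ) :
    ∃ F : Finset (ι × Bool →₀ ℕ), ∀ M : (ι × Bool →₀ ℕ) → ℝ,
      (∀ x : (ι × Bool →₀ ℕ) → ℂ,
        0 ≤ (∑ u ∈ F, ∑ v ∈ F, x u * conj (x v) * (M (u + starExp v) : ℂ)).re) →
      ∀ q : MvPolynomial (ι × Bool) ℝ, q.totalDegree ≤ D → 0 ≤ momentFunctional M (q * q) := by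
  classical
  have hfin : {m : ι × Bool →₀ ℕ | m.degree ≤ D}.Finite := Finsupp.finite_of_degree_le D
  refine ⟨hfin.toFinset.biUnion fun m => (toHol ι (MvPolynomial.monomial m 1)).support, fun M hM q hq => ?_⟩
  set F := hfin.toFinset.biUnion fun m => (toHol ι (MvPolynomial.monomial m 1)).support with hF
  have hsupp : (toHol ι q).support ⊆ F := by
    intro u hu
    rw [q.as_sum, map_sum] at hu
    obtain ⟨m, hm, hmu⟩ := Finset.mem_biUnion.1 (MvPolynomial.support_sum hu)
    refine Finset.mem_biUnion.2 ⟨m, ?_, ?_⟩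
    · rw [Set.Finite.mem_toFinset]
      exact (MvPolynomial.le_totalDegree hm).trans hq
    · rw [← mul_one (MvPolynomial.coeff m q), ← smul_eq_mul, ← MvPolynomial.smul_monomial, map_smul] at hmu
      exact MvPolynomial.support_smul hmu
  set f := toHol ι q with hf
  have h1 : f = ∑ u ∈ F, MvPolynomial.monomial u (MvPolynomial.coeff u f) := by
    conv_lhs => rw [f.as_sum]
    refine Finset.sum_subset hsupp fun u _ hu => ?_
    rw [MvPolynomial.notMem_support_iff.1 hu, map_zero]
  have h2 : f = ∑ u ∈ F, MvPolynomial.monomial (starExp u) (conj (MvPolynomial.coeff u f)) := by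
    conv_lhs => rw [hf, ← conjHol_toHol, ← hf, h1, map_sum]
    simp only [conjHol_monomial]
  have h3 : f * f = ∑ u ∈ F, ∑ v ∈ F, MvPolynomial.monomial (u + starExp v)
      (MvPolynomial.coeff u f * conj (MvPolynomial.coeff v f)) := by
    conv_lhs => rw [h2]
    conv_lhs => enter [1]; rw [← h2, h1]
    rw [Finset.sum_mul_sum]
    simp only [MvPolynomial.monomial_mul]
  rw [momentFunctional_apply, map_mul, ← hf, h3]
  simp only [map_sum, moments_monomial]
  exact hM fun u => MvPolynomial.coeff u f

/-- Vanishes exactly on the exponents of degree at most one. -/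
def excess {p : ℕ} (m : Fin p → ℕ) : ℕ := ∑ i, m i * (m i - 1) + (∑ i, m i) * ((∑ i, m i) - 1)

theorem cast_mul_pred (x : ℕ) : ((x * (x - 1) : ℕ) : ℤ) = x * x - x := by
  cases x with
  | zero => simp
  | succ n => push_cast [Nat.add_sub_cancel]; ring

theorem mul_pred_midpoint {x y z : ℕ} (h : x + y = 2 * z) : 2 * (z * (z - 1)) ≤ x * (x - 1) + y * (y - 1) := by
  rw [← Nat.cast_le (α := ℤ), Nat.cast_mul, Nat.cast_add, cast_mul_pred, cast_mul_pred, cast_mul_pred]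
  zify at h
  have hy : (y : ℤ) = 2 * z - x := by linarith
  rw [hy]
  push_cast
  nlinarith [sq_nonneg ((x : ℤ) - z)]

theorem mul_pred_midpoint_lt {x y z : ℕ} (h : x + y = 2 * z) (hxy : x ≠ y) :
    2 * (z * (z - 1)) < x * (x - 1) + y * (y - 1) := by
  rw [← Nat.cast_lt (α := ℤ), Nat.cast_mul, Nat.cast_add, cast_mul_pred, cast_mul_pred, cast_mul_pred]
  zify at h
  have hy : (y : ℤ) = 2 * z - x := by linarith
  have : 0 < ((x : ℤ) - z) ^ 2 := by
    have : (x : ℤ) - z ≠ 0 := fun h => hxy (by omega)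
    positivity
  rw [hy]
  push_cast
  nlinarith

theorem excess_midpoint {p : ℕ} {a b m : Fin p → ℕ} (h : ∀ i, a i + b i = 2 * m i) :
    2 * excess m ≤ excess a + excess b := by
  have h1 := mul_pred_midpoint (x := ∑ i, a i) (y := ∑ i, b i) (z := ∑ i, m i)
    (by simp [← Finset.sum_add_distrib, h, Finset.mul_sum])
  have h2 : ∑ i, 2 * (m i * (m i - 1)) ≤ ∑ i, (a i * (a i - 1) + b i * (b i - 1)) :=
    Finset.sum_le_sum fun i _ => mul_pred_midpoint (h i)
  rw [← Finset.mul_sum, Finset.sum_add_distrib] at h2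
  simp only [excess]
  omega

theorem excess_midpoint_lt {p : ℕ} {a b m : Fin p → ℕ} (h : ∀ i, a i + b i = 2 * m i) (hab : ∃ i, a i ≠ b i) :
    2 * excess m < excess a + excess b := by
  have h1 := mul_pred_midpoint (x := ∑ i, a i) (y := ∑ i, b i) (z := ∑ i, m i)
    (by simp [← Finset.sum_add_distrib, h, Finset.mul_sum])
  have h2 : ∑ i, 2 * (m i * (m i - 1)) < ∑ i, (a i * (a i - 1) + b i * (b i - 1)) := by
    obtain ⟨i, hi⟩ := hab
    exact Finset.sum_lt_sum (fun i _ => mul_pred_midpoint (h i)) ⟨i, Finset.mem_univ i, mul_pred_midpoint_lt (h i) hi⟩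
  rw [← Finset.mul_sum, Finset.sum_add_distrib] at h2
  simp only [excess]
  omega

theorem sum_le_one_of_excess_eq_zero {p : ℕ} {m : Fin p → ℕ} (h : excess m = 0) : ∑ i, m i ≤ 1 := by
  have := (Nat.add_eq_zero_iff.1 h).2
  rcases Nat.mul_eq_zero.1 this with h | h <;> omega

theorem excess_eq_zero_of_sum_le_one {p : ℕ} {m : Fin p → ℕ} (h : ∑ i, m i ≤ 1) : excess m = 0 := by
  have h1 : ∀ i, m i ≤ 1 := fun i => (Finset.single_le_sum (fun _ _ => Nat.zero_le _) (Finset.mem_univ i)).trans h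
  simp only [excess]
  rw [Finset.sum_eq_zero fun i _ => by rw [Nat.sub_eq_zero_of_le (h1 i), mul_zero], Nat.sub_eq_zero_of_le h, mul_zero, add_zero]

/-- Vanishes exactly on the exponents of degree at most one in either group of variables. -/
def biExcess {p q : ℕ} (m : Fin p ⊕ Fin q → ℕ) : ℕ := excess (fun i => m (.inl i)) + excess fun j => m (.inr j)

/-- Forgets which exponents belong to conjugate variables. -/
def absExp {ι : Type*} (u : ι × Bool → ℕ) : ι → ℕ := fun i => u (i, false) + u (i, true)

/-- The weighted degree, conjugate variables counting negatively. -/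
def charge {ι : Type*} [Fintype ι] (wt : ι → ℤ) (u : ι × Bool → ℕ) : ℤ :=
  ∑ i, ((u (i, false) : ℤ) - u (i, true)) * wt i

/-- Exponents of the monomials of degree at most one in either group of variables. -/
def lowExp {p q : ℕ} (a : Option (Fin p × Bool) × Option (Fin q × Bool)) : (Fin p ⊕ Fin q) × Bool → ℕ
  | (.inl i, b) => if a.1 = some (i, b) then 1 else 0
  | (.inr j, b) => if a.2 = some (j, b) then 1 else 0

theorem exists_indicator {α : Type*} [Fintype α] [DecidableEq α] (u : α → ℕ) (h : ∑ k, u k ≤ 1) :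
    ∃ o : Option α, ∀ k, u k = if o = some k then 1 else 0 := by
  by_cases h0 : ∀ k, u k = 0
  · exact ⟨none, fun k => by simp [h0 k]⟩
  · push Not at h0
    obtain ⟨k₀, hk₀⟩ := h0
    rw [← Finset.add_sum_erase _ _ (Finset.mem_univ k₀)] at h
    refine ⟨some k₀, fun k => ?_⟩
    by_cases hk : k₀ = k
    · subst hk
      simp
      omega
    · rw [if_neg (by simpa using hk)]
      have := Finset.single_le_sum (f := u) (fun _ _ => Nat.zero_le _) (Finset.mem_erase.2 ⟨Ne.symm hk, Finset.mem_univ k⟩)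
      omega

theorem exists_lowExp {p q : ℕ} (u : (Fin p ⊕ Fin q) × Bool → ℕ) (h : biExcess (absExp u) = 0) :
    ∃ a, u = lowExp a := by
  obtain ⟨h1, h2⟩ := Nat.add_eq_zero_iff.1 h
  obtain ⟨a, ha⟩ := exists_indicator (fun k : Fin p × Bool => u (.inl k.1, k.2)) (by
    have := sum_le_one_of_excess_eq_zero h1
    simpa [Fintype.sum_prod_type, absExp, add_comm] using this)
  obtain ⟨b, hb⟩ := exists_indicator (fun k : Fin q × Bool => u (.inr k.1, k.2)) (by
    have := sum_le_one_of_excess_eq_zero h2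
    simpa [Fintype.sum_prod_type, absExp, add_comm] using this)
  refine ⟨(a, b), funext fun k => ?_⟩
  rcases k with ⟨i | j, c⟩
  · exact ha (i, c)
  · exact hb (j, c)

theorem sum_indicator_le_one {α : Type*} [Fintype α] [DecidableEq α] (o : Option α) :
    ∑ k, (if o = some k then 1 else 0) ≤ 1 := by
  cases o <;> simp

theorem biExcess_lowExp {p q : ℕ} (a : Option (Fin p × Bool) × Option (Fin q × Bool)) :
    biExcess (absExp (lowExp a)) = 0 := by
  have h1 : excess (fun i => absExp (lowExp a) (.inl i)) = 0 := by
    refine excess_eq_zero_of_sum_le_one ?_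
    have := sum_indicator_le_one a.1
    rw [Fintype.sum_prod_type] at this
    simpa only [Fintype.sum_bool, absExp, add_comm, lowExp] using this
  have h2 : excess (fun i => absExp (lowExp a) (.inr i)) = 0 := by
    refine excess_eq_zero_of_sum_le_one ?_
    have := sum_indicator_le_one a.2
    rw [Fintype.sum_prod_type] at this
    simpa only [Fintype.sum_bool, absExp, add_comm, lowExp] using this
  rw [biExcess, h1, h2]

theorem biExcess_midpoint_lt {p q : ℕ} {u v : (Fin p ⊕ Fin q) × Bool → ℕ} {m : Fin p ⊕ Fin q → ℕ} (huv : u ≠ v)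
    (h1 : ∀ i, u (i, false) + v (i, true) = m i) (h2 : ∀ i, u (i, true) + v (i, false) = m i) :
    2 * biExcess m < biExcess (absExp u) + biExcess (absExp v) := by
  have h3 : ∀ i, absExp u i + absExp v i = 2 * m i := fun i => by
    have := h1 i
    have := h2 i
    simp only [absExp]
    omega
  have h4 : ∃ i, absExp u i ≠ absExp v i := by
    by_contra! h
    refine huv (funext fun k => ?_)
    rcases k with ⟨i, b⟩
    have := h1 i
    have := h2 i
    have := h i
    simp only [absExp] at this
    cases b <;> omega
  obtain ⟨i | j, hi⟩ := h4
  · have := excess_midpoint_lt (fun i => h3 (.inl i)) ⟨i, hi⟩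
    have := excess_midpoint (fun i => h3 (.inr i))
    simp only [biExcess]
    omega
  · have := excess_midpoint (fun i => h3 (.inl i))
    have := excess_midpoint_lt (fun i => h3 (.inr i)) ⟨j, hi⟩
    simp only [biExcess]
    omega

/-- Prescribed moments in low degrees for a functional that is nonnegative on squares. -/
structure MomentData (p q : ℕ) where
  wt : Fin p ⊕ Fin q → ℤ
  diag : (Fin p ⊕ Fin q → ℕ) → ℚ
  off : (Fin p ⊕ Fin q → ℕ) → ℚ
  amp : ((Fin p ⊕ Fin q) × Bool → ℕ) → ℚ
  le_diag : ∀ m, 1 / 4 ≤ diag m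
  diag_le : ∀ m, diag m ≤ 4
  off_nonneg : ∀ m, 0 ≤ off m
  off_le : ∀ m, off m ≤ 1
  amp_sq_le : ∀ a, amp (lowExp a) ^ 2 ≤ diag (absExp (lowExp a))
  off_eq : ∀ a b, a ≠ b → charge wt (lowExp a) = charge wt (lowExp b) →
    off (absExp (lowExp a) + absExp (lowExp b)) = amp (lowExp a) * amp (lowExp b)

open Classical in
/-- The moments prescribed by `d` in low degrees, with rapidly growing diagonal moments. -/
noncomputable def MomentData.moment {p q : ℕ} (d : MomentData p q) (r : ℝ) (g : (Fin p ⊕ Fin q) × Bool →₀ ℕ) : ℝ :=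
  if ∀ i, g (i, false) = g (i, true) then
    if biExcess (fun i => g (i, false)) = 0 then d.diag fun i => g (i, false)
    else r ^ (2 * biExcess fun i => g (i, false))
  else if charge d.wt g = 0 then 49 / 50 * d.off (absExp g) else 0

theorem charge_add_starExp {ι : Type*} [Fintype ι] (wt : ι → ℤ) (u v : ι × Bool →₀ ℕ) :
    charge wt ⇑(u + starExp v) = charge wt u - charge wt v := by
  simp only [charge, ← Finset.sum_sub_distrib]
  refine Finset.sum_congr rfl fun i _ => ?_
  simp [starExp_apply]
  ring

theorem absExp_add_starExp {ι : Type*} (u v : ι × Bool →₀ ℕ) :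
    absExp ⇑(u + starExp v) = absExp u + absExp v := by
  funext i
  simp [absExp, starExp_apply]
  ring

theorem MomentData.moment_diag {p q : ℕ} (d : MomentData p q) (r : ℝ) (u : (Fin p ⊕ Fin q) × Bool →₀ ℕ) :
    d.moment r (u + starExp u) = if biExcess (absExp u) = 0 then (d.diag (absExp u) : ℝ) else r ^ (2 * biExcess (absExp u)) := by
  have h : (fun i => (u + starExp u) (i, false)) = absExp u := by
    funext i
    simp [absExp, starExp_apply]
  rw [MomentData.moment, if_pos fun i => by simp [starExp_apply, add_comm], h]

theorem MomentData.moment_low {p q : ℕ} (d : MomentData p q) (r : ℝ) (u v : (Fin p ⊕ Fin q) × Bool →₀ ℕ)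
    (huv : u ≠ v) (hu : biExcess (absExp u) = 0) (hv : biExcess (absExp v) = 0) :
    d.moment r (u + starExp v) = if charge d.wt u = charge d.wt v then 49 / 50 * (d.amp u * d.amp v : ℝ) else 0 := by
  rw [MomentData.moment, if_neg, charge_add_starExp, absExp_add_starExp]
  · simp only [sub_eq_zero]
    obtain ⟨a, ha⟩ := exists_lowExp _ hu
    obtain ⟨b, hb⟩ := exists_lowExp _ hv
    split_ifs with h
    · have := d.off_eq a b (fun hab => huv (DFunLike.coe_injective (by rw [ha, hb, hab]))) (by rw [← ha, ← hb, h])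
      rw [ha, hb, this]
      push_cast
      rfl
    · rfl
  · intro h
    have := biExcess_midpoint_lt (m := fun i => (u + starExp v) (i, false)) (u := u) (v := v)
      (fun h => huv (DFunLike.coe_injective h)) (fun i => by simp [starExp_apply])
      (fun i => by rw [h i]; simp [starExp_apply])
    omega

theorem MomentData.abs_moment_le {p q : ℕ} (d : MomentData p q) {r : ℝ} (hr : 1 ≤ r)
    (u v : (Fin p ⊕ Fin q) × Bool →₀ ℕ)
    (huv : u ≠ v) (h0 : biExcess (absExp u) ≠ 0 ∨ biExcess (absExp v) ≠ 0) :
    |d.moment r (u + starExp v)| * r ≤ 4 * r ^ (biExcess (absExp u) + biExcess (absExp v)) := by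
  have hr0 : 0 ≤ r := by linarith
  have key : ∀ k, k < biExcess (absExp u) + biExcess (absExp v) → ∀ y : ℝ, |y| ≤ 4 * r ^ k →
      |y| * r ≤ 4 * r ^ (biExcess (absExp u) + biExcess (absExp v)) := fun k hk y hy => by
    calc |y| * r ≤ 4 * r ^ k * r := mul_le_mul_of_nonneg_right hy hr0
      _ = 4 * r ^ (k + 1) := by ring
      _ ≤ _ := mul_le_mul_of_nonneg_left (pow_le_pow_right₀ hr hk) (by norm_num)
  by_cases hd : ∀ i, (u + starExp v) (i, false) = (u + starExp v) (i, true)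
  · have := biExcess_midpoint_lt (m := fun i => (u + starExp v) (i, false)) (u := u) (v := v)
      (fun h => huv (DFunLike.coe_injective h)) (fun i => by simp [starExp_apply])
      (fun i => by rw [hd i]; simp [starExp_apply])
    refine key _ this _ ?_
    rw [MomentData.moment, if_pos hd]
    split_ifs with h
    · have h1 : (0 : ℝ) ≤ d.diag fun i => (u + starExp v) (i, false) := by
        exact_mod_cast (by norm_num : (0 : ℚ) ≤ 1 / 4).trans (d.le_diag _)
      rw [abs_of_nonneg h1, h]
      have : ((d.diag fun i => (u + starExp v) (i, false) : ℚ) : ℝ) ≤ 4 := by exact_mod_cast d.diag_le _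
      simpa using this
    · rw [abs_of_nonneg (by positivity)]
      have : 0 ≤ r ^ (2 * biExcess fun i => (u + starExp v) (i, false)) := by positivity
      linarith
  · refine key 0 (by omega) _ ?_
    rw [MomentData.moment, if_neg hd]
    have h1 : (0 : ℝ) ≤ d.off (absExp ⇑(u + starExp v)) := by exact_mod_cast d.off_nonneg _
    have h2 : (d.off (absExp ⇑(u + starExp v)) : ℝ) ≤ 1 := by exact_mod_cast d.off_le _
    split_ifs
    · rw [abs_of_nonneg (by positivity)]
      linarith
    · simp

theorem MomentData.exists_kernel_nonneg {p q : ℕ} (d : MomentData p q) (F : Finset ((Fin p ⊕ Fin q) × Bool →₀ ℕ)) :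
    ∃ r : ℝ, ∀ x : ((Fin p ⊕ Fin q) × Bool →₀ ℕ) → ℂ,
      0 ≤ (∑ u ∈ F, ∑ v ∈ F, x u * starRingEnd ℂ (x v) * (d.moment r (u + starExp v) : ℂ)).re := by
  classical
  set r : ℝ := 800 * F.card + 1 with hr
  have hr1 : 1 ≤ r := by
    have : (0 : ℝ) ≤ F.card := Nat.cast_nonneg _
    linarith
  have hr0 : 0 < r := by linarith
  refine ⟨r, kernel_nonneg F (fun u v => d.moment r (u + starExp v)) (fun u => charge d.wt u)
    (fun u => r ^ biExcess (absExp u)) (fun u => if biExcess (absExp u) = 0 then (d.amp u : ℝ) else 0)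
    (49 / 50) (1 / 200) (4 / r) (by norm_num) (by positivity) ?_ ?_ ?_⟩
  · rw [div_mul_eq_mul_div, div_le_iff₀ hr0, hr]
    linarith
  · intro u
    rw [d.moment_diag]
    split_ifs with h
    · obtain ⟨a, ha⟩ := exists_lowExp _ h
      have h1 := d.amp_sq_le a
      have h2 := d.le_diag (absExp u)
      rw [← ha] at h1
      have h3 : (d.amp u : ℝ) ^ 2 ≤ d.diag (absExp u) := by exact_mod_cast h1
      have h4 : (1 / 4 : ℝ) ≤ d.diag (absExp u) := by
        have : ((1 / 4 : ℚ) : ℝ) ≤ d.diag (absExp u) := by exact_mod_cast h2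
        simpa using this
      rw [h, pow_zero]
      linarith
    · rw [← pow_mul, mul_comm _ 2]
      have : 0 ≤ r ^ (2 * biExcess (absExp u)) := by positivity
      linarith
  · intro u v huv
    by_cases h : biExcess (absExp u) = 0 ∧ biExcess (absExp v) = 0
    · rw [d.moment_low r u v huv h.1 h.2, if_pos h.1, if_pos h.2, sub_self, abs_zero]
      positivity
    · have h1 := d.abs_moment_le hr1 u v huv (by tauto)
      have h2 : (if biExcess (absExp u) = 0 then (d.amp u : ℝ) else 0) * (if biExcess (absExp v) = 0 then (d.amp v : ℝ) else 0) = 0 := by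
        by_cases hu : biExcess (absExp u) = 0
        · rw [if_neg (fun hv => h ⟨hu, hv⟩), mul_zero]
        · rw [if_neg hu, zero_mul]
      simp only [h2, mul_zero, ite_self, sub_zero]
      rw [← pow_add, div_mul_eq_mul_div, le_div_iff₀ hr0]
      exact h1

theorem MomentData.exists_functional {p q : ℕ} (d : MomentData p q) (D : ℕ) :
    ∃ r : ℝ, ∀ f : MvPolynomial ((Fin p ⊕ Fin q) × Bool) ℝ, f.totalDegree ≤ D →
      0 ≤ momentFunctional (d.moment r) (f * f) := by
  obtain ⟨F, hF⟩ := momentFunctional_sq_nonneg (ι := Fin p ⊕ Fin q) D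
  obtain ⟨r, hr⟩ := d.exists_kernel_nonneg F
  exact ⟨r, hF _ hr⟩

/-- Real and imaginary part of a homogeneous coordinate, the coordinate `none` being `1`. -/
noncomputable def coordPart {ι : Type*} : Option ι → Bool → MvPolynomial (ι × Bool) ℤ
  | none, b => if b then 0 else 1
  | some i, b => MvPolynomial.X (i, b)

/-- Real and imaginary part of the coordinates of a product vector. -/
noncomputable def prodPart {p q : ℕ} (a : Option (Fin p) × Option (Fin q)) (b : Bool) :
    MvPolynomial ((Fin p ⊕ Fin q) × Bool) ℤ :=
  if b then coordPart (a.1.map Sum.inl) false * coordPart (a.2.map Sum.inr) true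
      + coordPart (a.1.map Sum.inl) true * coordPart (a.2.map Sum.inr) false
  else coordPart (a.1.map Sum.inl) false * coordPart (a.2.map Sum.inr) false
      - coordPart (a.1.map Sum.inl) true * coordPart (a.2.map Sum.inr) true

/-- The index of a holomorphic monomial. -/
def holIdx {p q : ℕ} (a : Option (Fin p) × Option (Fin q)) : Option (Fin p × Bool) × Option (Fin q × Bool) :=
  (a.1.map fun i => (i, false), a.2.map fun j => (j, false))

/-- The exponent of a coordinate of a product vector. -/
noncomputable def prodExp {p q : ℕ} (a : Option (Fin p) × Option (Fin q)) : (Fin p ⊕ Fin q) × Bool →₀ ℕ :=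
  Finsupp.equivFunOnFinite.symm (lowExp (holIdx a))

theorem coe_prodExp {p q : ℕ} (a : Option (Fin p) × Option (Fin q)) : ⇑(prodExp a) = lowExp (holIdx a) := rfl

theorem prodExp_injective {p q : ℕ} : Function.Injective (prodExp : Option (Fin p) × Option (Fin q) → _) := by
  intro a b h
  have h' : lowExp (holIdx a) = lowExp (holIdx b) := by rw [← coe_prodExp, h, coe_prodExp]
  rcases a with ⟨a, a'⟩
  rcases b with ⟨b, b'⟩
  have h1 : ∀ i, (a = some i ↔ b = some i) := fun i => by
    have := congrFun h' (.inl i, false)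
    simp [lowExp, holIdx] at this
    by_cases h1 : a = some i <;> by_cases h2 : b = some i <;> simp_all
  have h2 : ∀ i, (a' = some i ↔ b' = some i) := fun i => by
    have := congrFun h' (.inr i, false)
    simp [lowExp, holIdx] at this
    by_cases h1 : a' = some i <;> by_cases h2 : b' = some i <;> simp_all
  rw [Option.ext fun i => h1 i, Option.ext fun i => h2 i]

theorem toHol_coordPart {ι : Type*} (o : Option ι) :
    toHol ι (MvPolynomial.map (Int.castRingHom ℝ) (coordPart o false))
      + MvPolynomial.C Complex.I * toHol ι (MvPolynomial.map (Int.castRingHom ℝ) (coordPart o true))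
      = o.elim 1 fun i => MvPolynomial.X (i, false) := by
  cases o with
  | none => simp [coordPart]
  | some i =>
    have h : Complex.I * (-Complex.I / 2) = 1 / 2 := by
      rw [mul_div_assoc', mul_neg, Complex.I_mul_I, neg_neg]
    have h2 : (MvPolynomial.C (1 / 2) : MvPolynomial (ι × Bool) ℂ) + MvPolynomial.C (1 / 2) = 1 := by
      rw [← map_add]
      norm_num
    simp only [coordPart, MvPolynomial.map_X, toHol, MvPolynomial.aeval_X, if_true, Option.elim_some]
    rw [← mul_assoc, ← map_mul, h, if_neg (by simp)]
    linear_combination MvPolynomial.X (i, false) * h2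

theorem toHol_prodPart {p q : ℕ} (a : Option (Fin p) × Option (Fin q)) :
    toHol _ (MvPolynomial.map (Int.castRingHom ℝ) (prodPart a false))
      + MvPolynomial.C Complex.I * toHol _ (MvPolynomial.map (Int.castRingHom ℝ) (prodPart a true))
      = MvPolynomial.monomial (prodExp a) 1 := by
  have h1 := toHol_coordPart (a.1.map Sum.inl : Option (Fin p ⊕ Fin q))
  have h2 := toHol_coordPart (a.2.map Sum.inr : Option (Fin p ⊕ Fin q))
  have hI : (MvPolynomial.C Complex.I : MvPolynomial ((Fin p ⊕ Fin q) × Bool) ℂ) * MvPolynomial.C Complex.I = -1 := by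
    rw [← map_mul, Complex.I_mul_I]
    simp
  have h3 : (MvPolynomial.monomial (prodExp a) 1 : MvPolynomial ((Fin p ⊕ Fin q) × Bool) ℂ)
      = ((a.1.map Sum.inl : Option (Fin p ⊕ Fin q)).elim 1 fun i => MvPolynomial.X (i, false))
        * ((a.2.map Sum.inr : Option (Fin p ⊕ Fin q)).elim 1 fun i => MvPolynomial.X (i, false)) := by
    rcases a with ⟨_ | i, _ | j⟩
    · have : prodExp ((none, none) : Option (Fin p) × Option (Fin q)) = 0 := by
        ext ⟨k | k, b⟩ <;> simp [coe_prodExp, lowExp, holIdx]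
      simp [this]
    · have : prodExp ((none, some j) : Option (Fin p) × Option (Fin q)) = Finsupp.single (.inr j, false) 1 := by
        ext ⟨k | k, b⟩ <;> simp [coe_prodExp, lowExp, holIdx, Finsupp.single_apply, eq_comm]
      simp [this, MvPolynomial.X]
    · have : prodExp ((some i, none) : Option (Fin p) × Option (Fin q)) = Finsupp.single (.inl i, false) 1 := by
        ext ⟨k | k, b⟩ <;> simp [coe_prodExp, lowExp, holIdx, Finsupp.single_apply, eq_comm]
      simp [this, MvPolynomial.X]
    · have : prodExp ((some i, some j) : Option (Fin p) × Option (Fin q))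
          = Finsupp.single (.inl i, false) 1 + Finsupp.single (.inr j, false) 1 := by
        ext ⟨k | k, b⟩ <;> simp [coe_prodExp, lowExp, holIdx, Finsupp.single_apply, eq_comm]
      simp [this, MvPolynomial.X, MvPolynomial.monomial_mul]
  rw [h3, ← h1, ← h2]
  simp only [prodPart, if_true, Bool.false_eq_true, if_false, map_add, map_sub, map_mul]
  linear_combination (-toHol _ (MvPolynomial.map (Int.castRingHom ℝ) (coordPart (a.1.map Sum.inl) true))
    * toHol _ (MvPolynomial.map (Int.castRingHom ℝ) (coordPart (a.2.map Sum.inr) true))) * hI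

theorem toHol_prodPart_conj {p q : ℕ} (a : Option (Fin p) × Option (Fin q)) :
    toHol _ (MvPolynomial.map (Int.castRingHom ℝ) (prodPart a false))
      - MvPolynomial.C Complex.I * toHol _ (MvPolynomial.map (Int.castRingHom ℝ) (prodPart a true))
      = MvPolynomial.monomial (starExp (prodExp a)) 1 := by
  have h := congrArg (conjHol _) (toHol_prodPart a)
  rw [conjHol_monomial, map_add, map_mul, conjHol_toHol, conjHol_toHol, map_one] at h
  rw [← h]
  simp [conjHol, sub_eq_add_neg]

/-- Real part of an entry of the Gram matrix of the product vector. -/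
noncomputable def gramRe {p q : ℕ} (a b : Option (Fin p) × Option (Fin q)) : MvPolynomial ((Fin p ⊕ Fin q) × Bool) ℤ :=
  prodPart a false * prodPart b false + prodPart a true * prodPart b true

/-- The moments prescribed by `d` of the entries of the Gram matrix of the product vector. -/
def MomentData.entry {p q : ℕ} (d : MomentData p q) (a b : Option (Fin p) × Option (Fin q)) : ℚ :=
  if a = b then d.diag (absExp (lowExp (holIdx a)))
  else if charge d.wt (lowExp (holIdx a)) = charge d.wt (lowExp (holIdx b)) then
    49 / 50 * (d.amp (lowExp (holIdx a)) * d.amp (lowExp (holIdx b)))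
  else 0

theorem MomentData.moment_prodExp {p q : ℕ} (d : MomentData p q) (r : ℝ) (a b : Option (Fin p) × Option (Fin q)) :
    d.moment r (prodExp a + starExp (prodExp b)) = d.entry a b := by
  rw [MomentData.entry]
  by_cases hab : a = b
  · subst hab
    rw [d.moment_diag, if_pos rfl, coe_prodExp, if_pos (biExcess_lowExp _)]
  · rw [if_neg hab, d.moment_low _ _ _ (fun h => hab (prodExp_injective h)), coe_prodExp, coe_prodExp]
    · split_ifs <;> push_cast <;> rfl
    · exact biExcess_lowExp _
    · exact biExcess_lowExp _

theorem MomentData.entry_comm {p q : ℕ} (d : MomentData p q) (a b : Option (Fin p) × Option (Fin q)) :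
    d.entry a b = d.entry b a := by
  simp only [MomentData.entry, eq_comm, mul_comm]
  by_cases h : a = b
  · simp [h]
  · simp [h]

theorem MomentData.momentFunctional_gramRe {p q : ℕ} (d : MomentData p q) (r : ℝ)
    (a b : Option (Fin p) × Option (Fin q)) :
    momentFunctional (d.moment r) (MvPolynomial.map (Int.castRingHom ℝ) (gramRe a b)) = d.entry a b := by
  have h : toHol _ (MvPolynomial.map (Int.castRingHom ℝ) (gramRe a b))
      = MvPolynomial.monomial (prodExp a + starExp (prodExp b)) (1 / 2)
        + MvPolynomial.monomial (prodExp b + starExp (prodExp a)) (1 / 2) := by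
    have e : ∀ u v : (Fin p ⊕ Fin q) × Bool →₀ ℕ, (MvPolynomial.monomial (u + v) (1 / 2) : MvPolynomial _ ℂ)
        = MvPolynomial.C (1 / 2) * (MvPolynomial.monomial u 1 * MvPolynomial.monomial v 1) := fun u v => by
      rw [MvPolynomial.monomial_mul, MvPolynomial.C_mul_monomial]
      norm_num
    have hI : (MvPolynomial.C Complex.I : MvPolynomial ((Fin p ⊕ Fin q) × Bool) ℂ) * MvPolynomial.C Complex.I = -1 := by
      rw [← map_mul, Complex.I_mul_I]
      simp
    have h2 : (MvPolynomial.C (1 / 2) : MvPolynomial ((Fin p ⊕ Fin q) × Bool) ℂ) + MvPolynomial.C (1 / 2) = 1 := by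
      rw [← map_add]
      norm_num
    rw [e, e, ← toHol_prodPart a, ← toHol_prodPart b, ← toHol_prodPart_conj a, ← toHol_prodPart_conj b, gramRe]
    simp only [map_add, map_mul]
    set A := toHol _ (MvPolynomial.map (Int.castRingHom ℝ) (prodPart a false))
    set A' := toHol _ (MvPolynomial.map (Int.castRingHom ℝ) (prodPart a true))
    set B := toHol _ (MvPolynomial.map (Int.castRingHom ℝ) (prodPart b false))
    set B' := toHol _ (MvPolynomial.map (Int.castRingHom ℝ) (prodPart b true))
    linear_combination 2 * MvPolynomial.C (1 / 2) * A' * B' * hI - (A * B + A' * B') * h2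
  rw [momentFunctional_apply, h, map_add, moments_monomial, moments_monomial, d.moment_prodExp, d.moment_prodExp,
    d.entry_comm b a]
  rw [← add_mul]
  norm_num

/-- The affine coordinates `y` completed by the homogeneous coordinate `1`. -/
def homVec {ι : Type*} (y : ι → ℂ) : Option ι → ℂ := fun o => o.elim 1 y

/-- The product of two vectors with first coordinate `1`. -/
def prodVec {p q : ℕ} (y : Fin p ⊕ Fin q → ℂ) (a : Option (Fin p) × Option (Fin q)) : ℂ :=
  homVec (fun i => y (.inl i)) a.1 * homVec (fun i => y (.inr i)) a.2

/-- The complex number with the given real and imaginary parts. -/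
noncomputable def cplx {ι : Type*} (x : ι × Bool → ℝ) (i : ι) : ℂ := x (i, false) + x (i, true) * Complex.I

theorem aeval_prodPart {p q : ℕ} (x : (Fin p ⊕ Fin q) × Bool → ℝ) (a : Option (Fin p) × Option (Fin q)) :
    ((MvPolynomial.aeval x (prodPart a false) : ℝ) : ℂ) + (MvPolynomial.aeval x (prodPart a true) : ℝ) * Complex.I
      = prodVec (cplx x) a := by
  rcases a with ⟨_ | i, _ | j⟩
  · simp [prodPart, prodVec, homVec, coordPart, cplx]
  · simp [prodPart, prodVec, homVec, coordPart, cplx]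
  · simp [prodPart, prodVec, homVec, coordPart, cplx]
  · simp only [prodPart, prodVec, homVec, coordPart, cplx, Option.map_some, Option.elim_some, if_true, Bool.false_eq_true,
      if_false, map_add, map_sub, map_mul, MvPolynomial.aeval_X]
    push_cast
    linear_combination (-(x (.inl i, true) : ℂ) * x (.inr j, true)) * Complex.I_mul_I

/-- Imaginary part of an entry of the Gram matrix of the product vector. -/
noncomputable def gramIm {p q : ℕ} (a b : Option (Fin p) × Option (Fin q)) : MvPolynomial ((Fin p ⊕ Fin q) × Bool) ℤ :=
  prodPart a true * prodPart b false - prodPart a false * prodPart b true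

theorem sum_gram {p q : ℕ} (x : (Fin p ⊕ Fin q) × Bool → ℝ) :
    ∑ k : ((Option (Fin p) × Option (Fin q)) × (Option (Fin p) × Option (Fin q))) × Bool,
      MvPolynomial.aeval x (if k.2 then gramIm k.1.1 k.1.2 else gramRe k.1.1 k.1.2) •
        Matrix.single k.1.1 k.1.2 (if k.2 then Complex.I else 1)
      = Matrix.vecMulVec (prodVec (cplx x)) (star (prodVec (cplx x))) := by
  rw [Fintype.sum_prod_type, Fintype.sum_prod_type]
  ext a b
  simp only [Fintype.sum_bool, if_true, Bool.false_eq_true, if_false, Matrix.sum_apply, Matrix.add_apply,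
    Matrix.smul_apply, Matrix.single_apply]
  rw [Finset.sum_eq_single a, Finset.sum_eq_single b]
  · simp only [and_self, if_true, Matrix.vecMulVec_apply, Pi.star_apply, ← aeval_prodPart, gramIm, gramRe,
      Complex.real_smul, map_sub, map_add, map_mul, Complex.star_def, Complex.conj_ofReal, Complex.conj_I]
    push_cast
    linear_combination (((MvPolynomial.aeval x (prodPart a true) : ℝ) : ℂ) * (MvPolynomial.aeval x (prodPart b true) : ℝ)) * Complex.I_mul_I
  · intro c _ hc
    simp [hc]
  · simp
  · intro c _ hc
    simp [hc]
  · simp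

theorem aeval_sum_sq {p q : ℕ} (x : (Fin p ⊕ Fin q) × Bool → ℝ) :
    MvPolynomial.aeval x (∑ a : Option (Fin p) × Option (Fin q), gramRe a a)
      = ∑ a, Complex.normSq (prodVec (cplx x) a) := by
  simp only [map_sum, gramRe, ← aeval_prodPart, Complex.normSq_add_mul_I, map_add, map_mul, sq]

theorem sum_normSq_prodVec_pos {p q : ℕ} (y : Fin p ⊕ Fin q → ℂ) : 0 < ∑ a, Complex.normSq (prodVec y a) := by
  refine Finset.sum_pos' (fun _ _ => Complex.normSq_nonneg _) ⟨(none, none), Finset.mem_univ _, ?_⟩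
  simp [prodVec, homVec]

/-- The change of coordinates moving `c` to the origin and rescaling by `δ`. -/
def recenter {ι : Type*} [DecidableEq ι] (c : ι → ℂ) (δ : ℝ) : Matrix (Option ι) (Option ι) ℂ
  | none, none => δ
  | none, some _ => 0
  | some i, none => -c i
  | some i, some j => if i = j then 1 else 0

theorem recenter_mulVec {ι : Type*} [Fintype ι] [DecidableEq ι] (c y : ι → ℂ) (δ : ℝ) :
    recenter c δ *ᵥ homVec (fun i => c i + δ * y i) = (δ : ℂ) • homVec y := by
  funext o
  cases o with
  | none => simp [Matrix.mulVec, dotProduct, recenter, homVec, Fintype.sum_option]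
  | some i => simp [Matrix.mulVec, dotProduct, recenter, homVec, Fintype.sum_option]

/-- The real functional `M ↦ Re ∑ C a b * M a b` on complex matrices. -/
noncomputable def pairing {I : Type*} [Fintype I] (C : I → I → ℚ) : Matrix I I ℂ →ₗ[ℝ] ℝ where
  toFun M := (∑ a, ∑ b, (C a b : ℂ) * M a b).re
  map_add' M N := by simp [mul_add, Finset.sum_add_distrib]
  map_smul' r M := by
    rw [RingHom.id_apply, smul_eq_mul, ← Complex.re_ofReal_mul, Finset.mul_sum]
    simp only [Finset.mul_sum, Matrix.smul_apply, Complex.real_smul]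
    refine congrArg _ (Finset.sum_congr rfl fun a _ => Finset.sum_congr rfl fun b _ => by ring)

theorem pairing_apply {I : Type*} [Fintype I] (C : I → I → ℚ) (M : Matrix I I ℂ) :
    pairing C M = (∑ a, ∑ b, (C a b : ℂ) * M a b).re := rfl

/-- The congruence `M ↦ T * M * Tᴴ` as a real linear map. -/
noncomputable def congruence {I : Type*} [Fintype I] (T : Matrix I I ℂ) : Matrix I I ℂ →ₗ[ℝ] Matrix I I ℂ where
  toFun M := T * M * Tᴴ
  map_add' M N := by rw [mul_add, add_mul]
  map_smul' r M := by simp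

theorem congruence_apply {I : Type*} [Fintype I] (T M : Matrix I I ℂ) : congruence T M = T * M * Tᴴ := rfl

theorem exists_sum_vecMulVec {I : Type*} [Fintype I] [DecidableEq I] {σ : Matrix I I ℂ} (h : σ.PosSemidef) :
    ∃ v : I → I → ℂ, ∀ a b, σ a b = ∑ k, v k a * starRingEnd ℂ (v k b) := by
  open scoped MatrixOrder in
  obtain ⟨B, rfl⟩ := CStarAlgebra.nonneg_iff_eq_star_mul_self.1 (Matrix.nonneg_iff_posSemidef.2 h)
  exact ⟨fun k a => starRingEnd ℂ (B k a), fun a b => by simp [Matrix.mul_apply]⟩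

theorem pairing_kronecker_nonneg {I J : Type*} [Fintype I] [DecidableEq I] [Fintype J] [DecidableEq J]
    {C : I × J → I × J → ℚ}
    (hC : ∀ (v : I → ℂ) (w : J → ℂ), 0 ≤ (∑ a, ∑ b, (C a b : ℂ) * ((v a.1 * w a.2) * starRingEnd ℂ (v b.1 * w b.2))).re)
    {σ : Matrix I I ℂ} {τ : Matrix J J ℂ} (hσ : σ.PosSemidef) (hτ : τ.PosSemidef) : 0 ≤ pairing C (σ ⊗ₖ τ) := by
  obtain ⟨v, hv⟩ := exists_sum_vecMulVec hσ
  obtain ⟨w, hw⟩ := exists_sum_vecMulVec hτ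
  have h : ∑ a, ∑ b, (C a b : ℂ) * (σ ⊗ₖ τ) a b
      = ∑ k, ∑ l, ∑ a, ∑ b, (C a b : ℂ) * ((v k a.1 * w l a.2) * starRingEnd ℂ (v k b.1 * w l b.2)) := by
    have e : ∀ a b, (C a b : ℂ) * (σ ⊗ₖ τ) a b
        = ∑ k, ∑ l, (C a b : ℂ) * ((v k a.1 * w l a.2) * starRingEnd ℂ (v k b.1 * w l b.2)) := fun a b => by
      rw [Matrix.kroneckerMap_apply, hv, hw, Finset.sum_mul_sum, Finset.mul_sum]
      refine Finset.sum_congr rfl fun k _ => ?_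
      rw [Finset.mul_sum]
      refine Finset.sum_congr rfl fun l _ => ?_
      rw [map_mul]
      ring
    simp only [e]
    rw [Finset.sum_congr rfl fun a _ => Finset.sum_comm, Finset.sum_comm]
    refine Finset.sum_congr rfl fun k _ => ?_
    rw [Finset.sum_congr rfl fun a _ => Finset.sum_comm, Finset.sum_comm]
  rw [pairing_apply, h, Complex.re_sum]
  refine Finset.sum_nonneg fun k _ => ?_
  rw [Complex.re_sum]
  exact Finset.sum_nonneg fun l _ => hC _ _

theorem continuous_recenter {ι : Type*} [DecidableEq ι] (c : ι → ℂ) : Continuous fun δ : ℝ => recenter c δ := by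
  refine continuous_matrix fun i j => ?_
  rcases i with _ | i <;> rcases j with _ | j
  · exact Complex.continuous_ofReal
  all_goals exact continuous_const

theorem not_isSpectrahedralShadow_of_momentData {p q : ℕ} (d : MomentData p q)
    (C : Option (Fin p) × Option (Fin q) → Option (Fin p) × Option (Fin q) → ℚ)
    (hneg : ∑ a, ∑ b, C a b * d.entry a b < 0)
    (hC : ∀ (v : Option (Fin p) → ℂ) (w : Option (Fin q) → ℂ),
      0 ≤ (∑ a, ∑ b, (C a b : ℂ) * ((v a.1 * w a.2) * starRingEnd ℂ (v b.1 * w b.2))).re)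
    {S : Set (Matrix (Option (Fin p) × Option (Fin q)) (Option (Fin p) × Option (Fin q)) ℂ)}
    (hprod : ∀ y : Fin p ⊕ Fin q → ℂ, (∑ a, Complex.normSq (prodVec y a))⁻¹ •
      Matrix.vecMulVec (prodVec y) (star (prodVec y)) ∈ S)
    (hsep : ∀ M ∈ S, ∃ (r : ℕ) (σ : Fin r → Matrix (Option (Fin p)) (Option (Fin p)) ℂ)
      (τ : Fin r → Matrix (Option (Fin q)) (Option (Fin q)) ℂ),
      (∀ i, (σ i).PosSemidef) ∧ (∀ i, (τ i).PosSemidef) ∧ M = ∑ i, σ i ⊗ₖ τ i) :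
    ¬ IsSpectrahedralShadow S := by
  intro hS
  set T : ((Fin p ⊕ Fin q) × Bool → ℝ) → ℝ →
      Matrix (Option (Fin p) × Option (Fin q)) (Option (Fin p) × Option (Fin q)) ℂ := fun x δ =>
    recenter (fun i => cplx x (.inl i)) δ ⊗ₖ recenter (fun i => cplx x (.inr i)) δ with hT
  have hTv : ∀ x δ z, T x δ *ᵥ prodVec (cplx fun i => x i + δ * z i) = (δ ^ 2 : ℂ) • prodVec (cplx z) := by
    intro x δ z
    have e : ∀ i, cplx (fun i => x i + δ * z i) i = cplx x i + δ * cplx z i := fun i => by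
      simp only [cplx]
      push_cast
      ring
    have h1 := recenter_mulVec (fun i => cplx x (.inl i)) (fun i => cplx z (.inl i)) δ
    have h2 := recenter_mulVec (fun i => cplx x (.inr i)) (fun i => cplx z (.inr i)) δ
    funext a
    have h3 : (T x δ *ᵥ prodVec (cplx fun i => x i + δ * z i)) a
        = (recenter (fun i => cplx x (.inl i)) δ *ᵥ homVec (fun i => cplx x (.inl i) + δ * cplx z (.inl i))) a.1
          * (recenter (fun i => cplx x (.inr i)) δ *ᵥ homVec (fun i => cplx x (.inr i) + δ * cplx z (.inr i))) a.2 := by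
      simp only [Matrix.mulVec, dotProduct, Finset.sum_mul_sum, Fintype.sum_prod_type, hT, Matrix.kroneckerMap_apply,
        prodVec, e]
      refine Finset.sum_congr rfl fun i _ => Finset.sum_congr rfl fun j _ => by ring
    rw [h3, h1, h2]
    simp only [Pi.smul_apply, smul_eq_mul, prodVec]
    ring
  have hgram : ∀ y : Fin p ⊕ Fin q → ℂ, pairing C (Matrix.vecMulVec (prodVec y) (star (prodVec y)))
      = (∑ a, ∑ b, (C a b : ℂ) * (prodVec y a * starRingEnd ℂ (prodVec y b))).re := fun y => by
    simp [pairing_apply, Matrix.vecMulVec_apply]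
  have hWb : ∀ x v, ∃ c, 0 ≤ c ∧ ∀ δ, 0 < δ → δ ≤ 1 → |(pairing C ∘ₗ congruence (T x δ)) v| ≤ c := by
    intro x v
    have hc : Continuous fun δ : ℝ => (pairing C ∘ₗ congruence (T x δ)) v := by
      have h1 : Continuous fun δ : ℝ => T x δ := by
        refine continuous_matrix fun a b => ?_
        exact ((continuous_recenter _).matrix_elem a.1 b.1).mul ((continuous_recenter _).matrix_elem a.2 b.2)
      have h2 : Continuous fun δ : ℝ => T x δ * v * (T x δ)ᴴ :=
        (h1.matrix_mul continuous_const).matrix_mul h1.matrix_conjTranspose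
      simp only [LinearMap.comp_apply, pairing_apply, congruence_apply]
      refine Complex.continuous_re.comp (continuous_finsetSum _ fun a _ => continuous_finsetSum _ fun b _ => ?_)
      exact continuous_const.mul (h2.matrix_elem a b)
    obtain ⟨c, hc⟩ := (isCompact_Icc (a := (0 : ℝ)) (b := 1)).exists_bound_of_continuousOn hc.continuousOn
    refine ⟨c, (norm_nonneg _).trans (hc 0 (by simp)), fun δ h0 h1 => hc δ ⟨h0.le, h1⟩⟩
  have hWS : ∀ x δ, 0 < δ → δ ≤ 1 → ∀ s ∈ S, 0 ≤ (pairing C ∘ₗ congruence (T x δ)) s := by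
    intro x δ _ _ s hs
    obtain ⟨r, σ, τ, hσ, hτ, rfl⟩ := hsep s hs
    rw [map_sum]
    refine Finset.sum_nonneg fun i _ => ?_
    rw [LinearMap.comp_apply, congruence_apply, hT, Matrix.conjTranspose_kronecker, ← Matrix.mul_kronecker_mul,
      ← Matrix.mul_kronecker_mul]
    exact pairing_kronecker_nonneg hC ((hσ i).mul_mul_conjTranspose_same _) ((hτ i).mul_mul_conjTranspose_same _)
  have hWN : ∀ x δ, 0 < δ → δ ≤ 1 → ∀ z, (pairing C ∘ₗ congruence (T x δ))
      (∑ k : ((Option (Fin p) × Option (Fin q)) × (Option (Fin p) × Option (Fin q))) × Bool,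
        MvPolynomial.aeval (fun i => x i + δ * z i) (if k.2 then gramIm k.1.1 k.1.2 else gramRe k.1.1 k.1.2) •
          Matrix.single k.1.1 k.1.2 (if k.2 then Complex.I else 1))
      = δ ^ 4 * MvPolynomial.eval z
        (∑ a, ∑ b, (C a b : ℝ) • MvPolynomial.map (Int.castRingHom ℝ) (gramRe a b)) := by
    intro x δ _ _ z
    have h1 : congruence (T x δ) (Matrix.vecMulVec (prodVec (cplx fun i => x i + δ * z i))
        (star (prodVec (cplx fun i => x i + δ * z i))))
        = (δ ^ 4 : ℝ) • Matrix.vecMulVec (prodVec (cplx z)) (star (prodVec (cplx z))) := by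
      rw [congruence_apply, Matrix.mul_vecMulVec, Matrix.vecMulVec_mul, ← Matrix.star_mulVec, hTv]
      ext a b
      simp [Matrix.vecMulVec_apply]
      ring
    rw [sum_gram, LinearMap.comp_apply, h1, map_smul, smul_eq_mul, pairing_apply, Complex.re_sum, map_sum]
    simp only [Complex.re_sum, map_sum]
    refine congrArg _ (Finset.sum_congr rfl fun a _ => Finset.sum_congr rfl fun b _ => ?_)
    rw [MvPolynomial.smul_eval, MvPolynomial.eval_map, Matrix.vecMulVec_apply, ← Complex.ofReal_ratCast,
      Complex.re_ofReal_mul]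
    congr 1
    have h2 : MvPolynomial.eval₂ (Int.castRingHom ℝ) z (gramRe a b) = MvPolynomial.aeval z (gramRe a b) := rfl
    rw [h2, Pi.star_apply, ← aeval_prodPart, ← aeval_prodPart, gramRe]
    simp
  obtain ⟨D, hD⟩ := nonneg_of_isSpectrahedralShadow hS
    (fun k : ((Option (Fin p) × Option (Fin q)) × (Option (Fin p) × Option (Fin q))) × Bool =>
      Matrix.single k.1.1 k.1.2 (if k.2 then Complex.I else 1))
    (fun k => if k.2 then gramIm k.1.1 k.1.2 else gramRe k.1.1 k.1.2)
    (∑ a, gramRe a a) (fun x => by rw [aeval_sum_sq]; exact sum_normSq_prodVec_pos _)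
    (fun x => by rw [sum_gram, aeval_sum_sq]; exact hprod _)
    (∑ a, ∑ b, (C a b : ℝ) • MvPolynomial.map (Int.castRingHom ℝ) (gramRe a b))
    (fun x δ => pairing C ∘ₗ congruence (T x δ)) hWb hWS hWN
  obtain ⟨r, hr⟩ := d.exists_functional D
  have h := hD _ hr
  simp only [map_sum, map_smul, d.momentFunctional_gramRe, smul_eq_mul] at h
  have h' : (0 : ℚ) ≤ ∑ a, ∑ b, C a b * d.entry a b := by exact_mod_cast h
  exact absurd h' (not_le.2 hneg)

/-- Residue class modulo three of the position of an entry relative to the main diagonal. -/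
def cyclicShift (m : Fin 2 ⊕ Fin 2 → ℕ) : ℕ :=
  (m (.inr 0) + 2 * m (.inr 1) + 2 * (m (.inl 0) + 2 * m (.inl 1))) % 3

/-- The moments used in the case of two factors of dimension three. -/
def momentData33 : MomentData 2 2 where
  wt := Sum.elim ![1, 4] ![-1, -4]
  diag m := if cyclicShift m = 1 then 1 / 4 else if cyclicShift m = 2 then 4 else 1
  off _ := 1
  amp u := if cyclicShift (absExp u) = 1 then 1 / 2 else if cyclicShift (absExp u) = 2 then 2 else 1
  le_diag m := by split_ifs <;> norm_num
  diag_le m := by split_ifs <;> norm_num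
  off_nonneg _ := by norm_num
  off_le _ := by norm_num
  amp_sq_le := by decide +kernel
  off_eq := by decide +kernel

/-- The number of a homogeneous coordinate. -/
def coordNum {n : ℕ} (o : Option (Fin n)) : ℕ := o.elim 0 fun i => i + 1

/-- The coefficients of the Choi-type form on two factors of dimension three. -/
def choiCoeff (a b : Option (Fin 2) × Option (Fin 2)) : ℚ :=
  if a = b then
    if a.1 = a.2 ∨ (coordNum a.1 + 1) % 3 = coordNum a.2 then 1 else 0
  else if a.1 = a.2 ∧ b.1 = b.2 then -1 else 0

theorem sum_choiCoeff_neg : ∑ a, ∑ b, choiCoeff a b * momentData33.entry a b < 0 := by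
  decide +kernel

/-- The moments used in the case of factors of dimensions two and four. -/
def momentData24 : MomentData 1 3 where
  wt := Sum.elim ![1] ![-1, -2, -3]
  diag m := if m = Sum.elim ![0] ![0, 1, 0] then 4 else if m = Sum.elim ![1] ![0, 0, 1] then 1 / 4 else 1
  off m := if m = Sum.elim ![2] ![1, 0, 1] then 1 / 4 else 1
  amp u :=
    if absExp u = Sum.elim ![0] ![0, 1, 0] then 2
    else if absExp u = Sum.elim ![1] ![0, 0, 1] then 1 / 2
    else if absExp u = Sum.elim ![1] ![1, 0, 0] ∧ u (.inl 0, true) ≠ u (.inr 0, true) then 1 / 2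
    else 1
  le_diag m := by split_ifs <;> norm_num
  diag_le m := by split_ifs <;> norm_num
  off_nonneg m := by split_ifs <;> norm_num
  off_le m := by split_ifs <;> norm_num
  amp_sq_le := by decide +kernel
  off_eq := by decide +kernel

/-- The coefficients of the Woronowicz-type form on factors of dimensions two and four. -/
def woronowiczCoeff (a b : Option (Fin 1) × Option (Fin 3)) : ℚ :=
  if a = b then
    if a.1 = none then a.2.elim 1 ![7 / 4, 1 / 4, 1]
    else a.2.elim 1 ![1, 2, 4]
  else if a.1 = none ∧ b.1 ≠ none ∧ coordNum b.2 = coordNum a.2 + 1 then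
    -2 * a.2.elim 2 ![1, 2, 0]
  else 0

theorem sum_woronowiczCoeff_neg : ∑ a, ∑ b, woronowiczCoeff a b * momentData24.entry a b < 0 := by
  decide +kernel

theorem sum_choiCoeff_mul (g : Option (Fin 2) × Option (Fin 2) → Option (Fin 2) × Option (Fin 2) → ℝ) :
    ∑ a, ∑ b, (choiCoeff a b : ℝ) * g a b
      = g (none, none) (none, none) + g (some 0, some 0) (some 0, some 0) + g (some 1, some 1) (some 1, some 1)
        + g (none, some 0) (none, some 0) + g (some 0, some 1) (some 0, some 1) + g (some 1, none) (some 1, none)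
        - g (none, none) (some 0, some 0) - g (none, none) (some 1, some 1)
        - g (some 0, some 0) (none, none) - g (some 0, some 0) (some 1, some 1)
        - g (some 1, some 1) (none, none) - g (some 1, some 1) (some 0, some 0) := by
  simp [Fintype.sum_prod_type, Fintype.sum_option, choiCoeff, coordNum]
  ring

theorem sum_woronowiczCoeff_mul (g : Option (Fin 1) × Option (Fin 3) → Option (Fin 1) × Option (Fin 3) → ℝ) :
    ∑ a, ∑ b, (woronowiczCoeff a b : ℝ) * g a b
      = g (none, none) (none, none) + 7 / 4 * g (none, some 0) (none, some 0)
        + 1 / 4 * g (none, some 1) (none, some 1) + g (none, some 2) (none, some 2)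
        + g (some 0, none) (some 0, none) + g (some 0, some 0) (some 0, some 0)
        + 2 * g (some 0, some 1) (some 0, some 1) + 4 * g (some 0, some 2) (some 0, some 2)
        - 4 * g (none, none) (some 0, some 0) - 2 * g (none, some 0) (some 0, some 1)
        - 4 * g (none, some 1) (some 0, some 2) := by
  simp [Fintype.sum_prod_type, Fintype.sum_option, Fin.sum_univ_succ, woronowiczCoeff, coordNum]
  ring

theorem sum_div_le_one {a b c : ℝ} (ha : 0 ≤ a) (hb : 0 ≤ b) (hc : 0 ≤ c) :
    a / (2 * a + b) + b / (2 * b + c) + c / (2 * c + a) ≤ 1 := by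
  have half : ∀ x : ℝ, x / (2 * x) ≤ 1 / 2 := fun x => by
    rcases eq_or_ne x 0 with rfl | hx
    · norm_num
    · field_simp
      norm_num
  rcases ha.eq_or_lt with rfl | ha
  · have := half c
    have h1 : b / (2 * b + c) ≤ 1 / 2 := by
      rcases hb.eq_or_lt with rfl | hb
      · simp
      · rw [div_le_div_iff₀ (by positivity) (by norm_num)]
        linarith
    simp only [zero_div, add_zero, zero_add]
    linarith
  rcases hb.eq_or_lt with rfl | hb
  · have := half a
    have h1 : c / (2 * c + a) ≤ 1 / 2 := by
      rw [div_le_div_iff₀ (by positivity) (by norm_num)]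
      linarith
    simp only [zero_div, add_zero]
    linarith
  rw [div_add_div _ _ (by positivity) (by positivity), div_add_div _ _ (by positivity) (by positivity),
    div_le_one (by positivity)]
  nlinarith [mul_nonneg ha.le (sq_nonneg (b - c)), mul_nonneg hb.le (sq_nonneg (c - a)), mul_nonneg hc (sq_nonneg (a - b)),
    mul_nonneg ha.le (sq_nonneg (a - b)), mul_nonneg ha.le (sq_nonneg (a - c)), mul_nonneg hb.le (sq_nonneg (a - b)),
    mul_nonneg hb.le (sq_nonneg (b - c)), mul_nonneg hc (sq_nonneg (b - c)), mul_nonneg hc (sq_nonneg (a - c))]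

theorem choi_form_nonneg (x y : Fin 3 → ℝ) :
    (∑ i, x i * y i) ^ 2 ≤ ∑ i, x i ^ 2 * (2 * y i ^ 2 + y (i + 1) ^ 2) := by
  have h := Finset.sum_sq_le_sum_mul_sum_of_sq_le_mul Finset.univ (r := fun i => x i * y i)
    (f := fun i => x i ^ 2 * (2 * y i ^ 2 + y (i + 1) ^ 2)) (g := fun i => y i ^ 2 / (2 * y i ^ 2 + y (i + 1) ^ 2))
    (fun i _ => by positivity) (fun i _ => by positivity) (fun i _ => by
      rcases eq_or_ne (y i) 0 with h | h
      · simp [h]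
      · have : 0 < 2 * y i ^ 2 + y (i + 1) ^ 2 := by positivity
        refine le_of_eq ?_
        field_simp)
  have h1 := sum_div_le_one (sq_nonneg (y 0)) (sq_nonneg (y 1)) (sq_nonneg (y 2))
  have h2 : ∑ i, y i ^ 2 / (2 * y i ^ 2 + y (i + 1) ^ 2) ≤ 1 := by
    simpa [Fin.sum_univ_three] using h1
  refine h.trans (mul_le_of_le_one_right (Finset.sum_nonneg fun i _ => by positivity) h2)

theorem re_mul_conj_self_mul (a b : ℂ) : (a * b * starRingEnd ℂ (a * b)).re = (‖a‖ * ‖b‖) ^ 2 := by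
  rw [Complex.mul_conj, Complex.ofReal_re, Complex.normSq_eq_norm_sq, norm_mul]

theorem re_mul_conj_mul_le (a b c d : ℂ) : (a * b * starRingEnd ℂ (c * d)).re ≤ ‖a‖ * ‖b‖ * (‖c‖ * ‖d‖) := by
  refine (Complex.re_le_norm _).trans_eq ?_
  rw [norm_mul, RCLike.norm_conj, norm_mul, norm_mul]

theorem re_sum_ratCast_mul {I : Type*} [Fintype I] (C : I → I → ℚ) (g : I → I → ℂ) :
    (∑ a, ∑ b, (C a b : ℂ) * g a b).re = ∑ a, ∑ b, (C a b : ℝ) * (g a b).re := by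
  rw [Complex.re_sum]
  refine Finset.sum_congr rfl fun a _ => ?_
  rw [Complex.re_sum]
  refine Finset.sum_congr rfl fun b _ => ?_
  rw [← Complex.ofReal_ratCast, Complex.re_ofReal_mul]

theorem choiCoeff_nonneg (v w : Option (Fin 2) → ℂ) :
    0 ≤ (∑ a, ∑ b, (choiCoeff a b : ℂ) * ((v a.1 * w a.2) * starRingEnd ℂ (v b.1 * w b.2))).re := by
  rw [re_sum_ratCast_mul, sum_choiCoeff_mul]
  simp only [re_mul_conj_self_mul]
  have h := choi_form_nonneg ![‖v none‖, ‖v (some 0)‖, ‖v (some 1)‖] ![‖w none‖, ‖w (some 0)‖, ‖w (some 1)‖]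
  simp [Fin.sum_univ_three] at h
  linarith [re_mul_conj_mul_le (v none) (w none) (v (some 0)) (w (some 0)),
    re_mul_conj_mul_le (v none) (w none) (v (some 1)) (w (some 1)),
    re_mul_conj_mul_le (v (some 0)) (w (some 0)) (v none) (w none),
    re_mul_conj_mul_le (v (some 0)) (w (some 0)) (v (some 1)) (w (some 1)),
    re_mul_conj_mul_le (v (some 1)) (w (some 1)) (v none) (w none),
    re_mul_conj_mul_le (v (some 1)) (w (some 1)) (v (some 0)) (w (some 0))]

theorem quartic_nonneg (X Y : ℝ) :
    X * Y * ((X + Y) * (X + 4 * Y)) ≤ (7 / 4 * X ^ 2 - 5 / 4 * (X * Y) + Y ^ 2) * (X ^ 2 / 4 - X * Y + 8 * Y ^ 2) := by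
  nlinarith [sq_nonneg (X ^ 2 - 7 / 2 * X * Y + 3 * Y ^ 2), sq_nonneg (X * Y), sq_nonneg (Y ^ 2), sq_nonneg (X ^ 2),
    sq_nonneg (X ^ 2 - 3 * X * Y), sq_nonneg (X * Y - Y ^ 2), sq_nonneg (X ^ 2 - 4 * X * Y + 4 * Y ^ 2)]

theorem woronowicz_form_nonneg (x y t₀ t₁ t₂ t₃ : ℝ) :
    4 * (x * t₀ * (y * t₁)) + 2 * (x * t₁ * (y * t₂)) + 4 * (x * t₂ * (y * t₃))
      ≤ (x ^ 2 + y ^ 2) * t₀ ^ 2 + (7 / 4 * x ^ 2 + y ^ 2) * t₁ ^ 2 + (1 / 4 * x ^ 2 + 2 * y ^ 2) * t₂ ^ 2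
        + (x ^ 2 + 4 * y ^ 2) * t₃ ^ 2 := by
  rcases eq_or_ne x 0 with rfl | hx
  · simp only [zero_mul, mul_zero, add_zero]
    positivity
  set E := 7 / 4 * (x ^ 2) ^ 2 - 5 / 4 * (x ^ 2 * y ^ 2) + (y ^ 2) ^ 2 with hE
  set G := (x ^ 2) ^ 2 / 4 - x ^ 2 * y ^ 2 + 8 * (y ^ 2) ^ 2 with hG
  have hq : x ^ 2 * y ^ 2 * ((x ^ 2 + y ^ 2) * (x ^ 2 + 4 * y ^ 2)) ≤ E * G :=
    quartic_nonneg _ _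
  have hx2 : 0 < x ^ 2 := by positivity
  have hEp : 0 < E := by
    have : 0 < (x ^ 2) ^ 2 := by positivity
    nlinarith [sq_nonneg (x ^ 2 - y ^ 2)]
  have h0 : 0 < x ^ 2 + y ^ 2 := by positivity
  have h3 : 0 < x ^ 2 + 4 * y ^ 2 := by positivity
  set P := E * (x ^ 2 + 4 * y ^ 2) with hP
  set Q := G * (x ^ 2 + y ^ 2) with hQ
  set R := x * y * ((x ^ 2 + y ^ 2) * (x ^ 2 + 4 * y ^ 2)) with hR
  have hPp : 0 < P := mul_pos hEp h3
  have hPQ : R ^ 2 ≤ P * Q := by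
    have := mul_le_mul_of_nonneg_right hq (mul_pos h0 h3).le
    rw [hP, hQ, hR]
    linarith
  have hmid : 0 ≤ P * t₁ ^ 2 - 2 * R * (t₁ * t₂) + Q * t₂ ^ 2 := by
    refine nonneg_of_mul_nonneg_right (b := P * t₁ ^ 2 - 2 * R * (t₁ * t₂) + Q * t₂ ^ 2) ?_ hPp
    nlinarith [sq_nonneg (P * t₁ - R * t₂), mul_le_mul_of_nonneg_right hPQ (sq_nonneg t₂)]
  rw [← sub_nonneg]
  refine nonneg_of_mul_nonneg_right (a := (x ^ 2 + y ^ 2) * (x ^ 2 + 4 * y ^ 2)) ?_ (mul_pos h0 h3)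
  have h1 := mul_nonneg h3.le (sq_nonneg ((x ^ 2 + y ^ 2) * t₀ - 2 * (x * y) * t₁))
  have h2 := mul_nonneg h0.le (sq_nonneg ((x ^ 2 + 4 * y ^ 2) * t₃ - 2 * (x * y) * t₂))
  refine (add_nonneg (add_nonneg h1 h2) hmid).trans_eq ?_
  rw [hP, hQ, hR, hE, hG]
  ring

theorem woronowiczCoeff_nonneg (v : Option (Fin 1) → ℂ) (w : Option (Fin 3) → ℂ) :
    0 ≤ (∑ a, ∑ b, (woronowiczCoeff a b : ℂ) * ((v a.1 * w a.2) * starRingEnd ℂ (v b.1 * w b.2))).re := by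
  rw [re_sum_ratCast_mul, sum_woronowiczCoeff_mul]
  simp only [re_mul_conj_self_mul]
  linarith [woronowicz_form_nonneg ‖v none‖ ‖v (some 0)‖ ‖w none‖ ‖w (some 0)‖ ‖w (some 1)‖ ‖w (some 2)‖,
    re_mul_conj_mul_le (v none) (w none) (v (some 0)) (w (some 0)),
    re_mul_conj_mul_le (v none) (w (some 0)) (v (some 0)) (w (some 1)),
    re_mul_conj_mul_le (v none) (w (some 1)) (v (some 0)) (w (some 2))]

theorem IsSpectrahedralShadow.image {V W : Type*} [AddCommGroup V] [Module ℝ V] [AddCommGroup W] [Module ℝ W]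
    {S : Set V} (hS : IsSpectrahedralShadow S) (f : V →ₗ[ℝ] W) : IsSpectrahedralShadow (f '' S) := by
  obtain ⟨n, m, A₀, A, L, h₀, h, rfl⟩ := hS
  exact ⟨n, m, A₀, A, f ∘ₗ L, h₀, h, by rw [Set.image_image]; rfl⟩

/-- The set of separable states. -/
def sepStates (d s : ℕ) : Set (Matrix (Fin d × Fin s) (Fin d × Fin s) ℂ) :=
  {ρ | ρ.PosSemidef ∧ ρ.trace = 1 ∧ SeparableMat ρ}

/-- Passing to a submatrix as a real linear map. -/
def submatrixLin {I J : Type*} (g : I → J) : Matrix J J ℂ →ₗ[ℝ] Matrix I I ℂ where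
  toFun M := M.submatrix g g
  map_add' _ _ := rfl
  map_smul' _ _ := rfl

theorem submatrixLin_apply {I J : Type*} (g : I → J) (M : Matrix J J ℂ) : submatrixLin g M = M.submatrix g g := rfl

theorem submatrixLin_swap_mem {d s : ℕ} {ρ : Matrix (Fin d × Fin s) (Fin d × Fin s) ℂ} (h : ρ ∈ sepStates d s) :
    submatrixLin Prod.swap ρ ∈ sepStates s d := by
  obtain ⟨h1, h2, r, σ, τ, hσ, hτ, h3⟩ := h
  refine ⟨h1.submatrix _, ?_, r, τ, σ, hτ, hσ, ?_⟩
  · rw [← h2]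
    exact Fintype.sum_equiv (Equiv.prodComm _ _) _ _ fun _ => rfl
  · rw [h3, map_sum]
    refine Finset.sum_congr rfl fun i _ => ?_
    ext a b
    simp [submatrixLin_apply, mul_comm]

theorem isSpectrahedralShadow_sepStates_swap {d s : ℕ} (h : IsSpectrahedralShadow (sepStates d s)) :
    IsSpectrahedralShadow (sepStates s d) := by
  convert h.image (submatrixLin Prod.swap) using 1
  refine Set.Subset.antisymm (fun ρ hρ => ⟨_, submatrixLin_swap_mem hρ, rfl⟩) ?_
  rintro _ ⟨ρ, hρ, rfl⟩
  exact submatrixLin_swap_mem hρ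

theorem sum_normSq_extend {I J : Type*} [Fintype I] [Fintype J] {e : I → J} (he : Function.Injective e) (v : I → ℂ) :
    ∑ j, Complex.normSq (Function.extend e v 0 j) = ∑ i, Complex.normSq (v i) := by
  refine (Finset.sum_of_injOn e he.injOn (fun _ _ => Finset.mem_coe.2 (Finset.mem_univ _)) (fun j _ hj => ?_)
    fun i _ => ?_).symm
  · rw [Function.extend_apply']
    · simp
    · rintro ⟨i, hi⟩
      exact hj ⟨i, Finset.mem_coe.2 (Finset.mem_univ _), hi⟩
  · rw [he.extend_apply]

theorem trace_vecMulVec_star {J : Type*} [Fintype J] (v : J → ℂ) :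
    (Matrix.vecMulVec v (star v)).trace = ((∑ j, Complex.normSq (v j) : ℝ) : ℂ) := by
  simp [Matrix.trace, Matrix.vecMulVec_apply, Complex.mul_conj]

theorem not_isSpectrahedralShadow_sepStates {p q d s : ℕ} (m : MomentData p q)
    (C : Option (Fin p) × Option (Fin q) → Option (Fin p) × Option (Fin q) → ℚ)
    (hneg : ∑ a, ∑ b, C a b * m.entry a b < 0)
    (hC : ∀ (v : Option (Fin p) → ℂ) (w : Option (Fin q) → ℂ),
      0 ≤ (∑ a, ∑ b, (C a b : ℂ) * ((v a.1 * w a.2) * starRingEnd ℂ (v b.1 * w b.2))).re)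
    (hp : p < d) (hq : q < s) : ¬ IsSpectrahedralShadow (sepStates d s) := by
  intro hS
  obtain ⟨e⟩ : Nonempty (Option (Fin p) ↪ Fin d) := Function.Embedding.nonempty_of_card_le (by simpa using hp)
  obtain ⟨f⟩ : Nonempty (Option (Fin q) ↪ Fin s) := Function.Embedding.nonempty_of_card_le (by simpa using hq)
  refine not_isSpectrahedralShadow_of_momentData m C hneg hC ?_ ?_ (hS.image (submatrixLin (Prod.map e f)))
  · intro y
    set v := Function.extend e (homVec fun i => y (.inl i)) 0 with hv
    set w := Function.extend f (homVec fun i => y (.inr i)) 0 with hw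
    set t := ∑ a, Complex.normSq (prodVec y a) with ht
    have htpos : 0 < t := sum_normSq_prodVec_pos y
    have hσ : (t⁻¹ • Matrix.vecMulVec v (star v)).PosSemidef :=
      (Matrix.posSemidef_vecMulVec_self_star v).smul (inv_nonneg.2 htpos.le)
    have hτ : (Matrix.vecMulVec w (star w)).PosSemidef := Matrix.posSemidef_vecMulVec_self_star w
    refine ⟨(t⁻¹ • Matrix.vecMulVec v (star v)) ⊗ₖ Matrix.vecMulVec w (star w), ⟨hσ.kronecker hτ, ?_, 1,
      fun _ => t⁻¹ • Matrix.vecMulVec v (star v), fun _ => Matrix.vecMulVec w (star w), fun _ => hσ, fun _ => hτ,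
      by simp⟩, ?_⟩
    · have h : t = (∑ j, Complex.normSq (v j)) * ∑ j, Complex.normSq (w j) := by
        rw [hv, hw, sum_normSq_extend e.injective, sum_normSq_extend f.injective, Finset.sum_mul_sum, ht,
          Fintype.sum_prod_type]
        simp only [prodVec, Complex.normSq_mul]
      rw [Matrix.trace_kronecker, Matrix.trace_smul, trace_vecMulVec_star, trace_vecMulVec_star, Complex.real_smul,
        mul_assoc, ← Complex.ofReal_mul, ← h, ← Complex.ofReal_mul, inv_mul_cancel₀ htpos.ne', Complex.ofReal_one]
    · ext a b
      simp only [submatrixLin_apply, Matrix.submatrix_apply, Matrix.kroneckerMap_apply, Matrix.smul_apply,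
        Matrix.vecMulVec_apply, Prod.map_fst, Prod.map_snd, Pi.star_apply, hv, hw, e.injective.extend_apply,
        f.injective.extend_apply, prodVec, star_mul', Complex.real_smul]
      ring
  · rintro _ ⟨ρ, ⟨-, -, r, σ, τ, hσ, hτ, rfl⟩, rfl⟩
    refine ⟨r, fun i => (σ i).submatrix e e, fun i => (τ i).submatrix f f, fun i => (hσ i).submatrix e,
      fun i => (hτ i).submatrix f, ?_⟩
    rw [map_sum]
    rfl

/-- For `d, s ≥ 2` with `d + s > 5`, the set of separable quantum states
(separable positive semidefinite matrices of trace one) is not a spectrahedral shadow. -/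
theorem sep_states_not_spectrahedral_shadow (d s : ℕ) (hd : 2 ≤ d) (hs : 2 ≤ s)
    (hds : 5 < d + s) :
    ¬ IsSpectrahedralShadow {ρ : Matrix (Fin d × Fin s) (Fin d × Fin s) ℂ |
        ρ.PosSemidef ∧ ρ.trace = 1 ∧ SeparableMat ρ} := by
  change ¬ IsSpectrahedralShadow (sepStates d s)
  by_cases hs4 : 4 ≤ s
  · exact not_isSpectrahedralShadow_sepStates momentData24 woronowiczCoeff sum_woronowiczCoeff_neg woronowiczCoeff_nonneg
      hd hs4
  by_cases hd4 : 4 ≤ d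
  · exact fun h => not_isSpectrahedralShadow_sepStates momentData24 woronowiczCoeff sum_woronowiczCoeff_neg
      woronowiczCoeff_nonneg hs hd4 (isSpectrahedralShadow_sepStates_swap h)
  · exact not_isSpectrahedralShadow_sepStates momentData33 choiCoeff sum_choiCoeff_neg choiCoeff_nonneg
      (by omega) (by omega)
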